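/- arXiv:2409.09903 — 5 statements merged into one kernel-verified Lean document; each statement's English description precedes it below -/
import Mathlib

section
/- Grant Assumption 1. Suppose ω_1* and ω_2* are two parameter points with π(x_j;ω_1*) = π(x_j;ω_2*) for all j ∈ [p], and both satisfy the separation condition σ̲² min_{k≠k'} ‖θ_k − θ_{k'}‖_2² ≥ C{log K + log(σ̄²/σ̲²) + log(ᾱ/α̲)} for their respective atoms. If d(ω_1*, ω_2*) ≤ δ_0/2, where δ_0 ≤ c_0 σ̄/(ς² ‖𝐗‖_{∞,2}) with c_0 ∈ [0,1/2) sufficiently small, then ω_1* = ω_2*. -/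
open scoped BigOperators
open Filter

noncomputable section
namespace SM

/-- Vectors in `ℝ^L`. -/
abbrev Vec (L : ℕ) := Fin L → ℝ

/-- Euclidean inner product. -/
def dot {L : ℕ} (v w : Vec L) : ℝ := ∑ l, v l * w l

/-- Euclidean norm. -/
def nrm {L : ℕ} (v : Vec L) : ℝ := Real.sqrt (∑ l, (v l) ^ 2)

/-- Softmax mixture parameters `ω = (α, θ_1, …, θ_K)`. -/
structure Param (L K : ℕ) where
  a : Fin K → ℝ
  t : Fin K → Vec L

/-- Softmax probabilities `A(x_j; θ)`. -/
def softA {L p : ℕ} (x : Fin p → Vec L) (θ : Vec L) (j : Fin p) : ℝ :=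
  Real.exp (dot (x j) θ) / ∑ i, Real.exp (dot (x i) θ)

/-- Softmax mixture `π(x_j; ω)`. -/
def mixP {L p K : ℕ} (x : Fin p → Vec L) (ω : Param L K) (j : Fin p) : ℝ :=
  ∑ k, ω.a k * softA x (ω.t k) j

/-- Membership in the probability simplex `Δ^K`. -/
def Simplex {K : ℕ} (a : Fin K → ℝ) : Prop := (∀ k, 0 ≤ a k) ∧ ∑ k, a k = 1

/-- Negative cross entropy `ℓ(ω) = ∑_j π(x_j; ωtrue) log π(x_j; ω)`. -/
def loglik {L p K : ℕ} (x : Fin p → Vec L) (ωtrue ω : Param L K) : ℝ :=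
  ∑ j, mixP x ωtrue j * Real.log (mixP x ω j)

/-- The set `Ω*` of maximizers of `ℓ`. -/
def OmegaStar {L p K : ℕ} (x : Fin p → Vec L) (ωtrue : Param L K) : Set (Param L K) :=
  {ω | Simplex ω.a ∧ ∀ ω', Simplex ω'.a → loglik x ωtrue ω' ≤ loglik x ωtrue ω}

/-- Segment `u θ_a + (1-u) θ_b`. -/
def seg {L : ℕ} (θa θb : Vec L) (u : ℝ) : Vec L := fun l => u * θa l + (1 - u) * θb l

/-- Quadratic form `vᵀ 𝐗ᵀ diag(A(θ)) 𝐗 v`. -/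
def qSecond {L p : ℕ} (x : Fin p → Vec L) (θ v : Vec L) : ℝ :=
  ∑ j, softA x θ j * (dot (x j) v) ^ 2

/-- Quadratic form `vᵀ H_θ v` of the Fisher information matrix
`H_θ = 𝐗ᵀ (diag(A(θ)) - A(θ)A(θ)ᵀ) 𝐗`. -/
def qH {L p : ℕ} (x : Fin p → Vec L) (θ v : Vec L) : ℝ :=
  qSecond x θ v - (∑ j, softA x θ j * dot (x j) v) ^ 2

/-- Assumption 1: `σ̲² ≤ λ_L(H_θ) ≤ λ_1(H_θ) ≤ σ̄²` and
`λ_1(H_θ^{-1/2} 𝐗ᵀ diag(A(θ)) 𝐗 H_θ^{-1/2}) ≤ ς²` (equivalently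
`𝐗ᵀ diag(A(θ)) 𝐗 ⪯ ς² H_θ`), along all segments between atoms of any maximizer,
expressed through quadratic forms over unit vectors. -/
def Assumption1 {L p K : ℕ} (x : Fin p → Vec L) (ωtrue : Param L K)
    (σlow σbar ς : ℝ) : Prop :=
  ∀ ωs ∈ OmegaStar x ωtrue, ∀ a b : Fin K, ∀ u ∈ Set.Icc (0:ℝ) 1, ∀ v : Vec L, nrm v = 1 →
    σlow ^ 2 ≤ qH x (seg (ωs.t a) (ωs.t b) u) v ∧
    qH x (seg (ωs.t a) (ωs.t b) u) v ≤ σbar ^ 2 ∧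
    qSecond x (seg (ωs.t a) (ωs.t b) u) v ≤ ς ^ 2 * qH x (seg (ωs.t a) (ωs.t b) u) v

/-- `‖𝐗‖_{∞,2} = max_j ‖x_j‖_2`. -/
def Xnorm {L p : ℕ} (x : Fin p → Vec L) : ℝ := ⨆ j, nrm (x j)

/-- The distance `d(ω, ω') = max{σ̄ max_k ‖θ_k - θ_k'‖_2, α̲⁻¹ ‖α - α'‖_∞}`. -/
def dParam {L K : ℕ} (σbar αlow : ℝ) (ω ω' : Param L K) : ℝ :=
  max (σbar * ⨆ k, nrm fun l => ω.t k l - ω'.t k l)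
      (αlow⁻¹ * ⨆ k, |ω.a k - ω'.a k|)

/-- `𝐗ᵀ A(θ) = ∑_j A(x_j;θ) x_j`. -/
def XtA {L p : ℕ} (x : Fin p → Vec L) (θ : Vec L) : Vec L :=
  fun l => ∑ j, softA x θ j * x j l

/-- One step of the (hybrid) EM algorithm, with weights `w` (equal to `π(·;ω*)` for the
population-level EM, or to the empirical frequencies for the sample-level EM) and step
sizes `η_k`. -/
def emStep {L p K : ℕ} (x : Fin p → Vec L) (w : Fin p → ℝ) (η : Fin K → ℝ)
    (ω : Param L K) : Param L K where
  a := fun k => ∑ j, w j * (ω.a k * softA x (ω.t k) j / mixP x ω j)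
  t := fun k l => ω.t k l +
    η k * ∑ j, w j * (ω.a k * softA x (ω.t k) j / mixP x ω j) * (x j l - XtA x (ω.t k) l)

/-- The separation condition
`σ̲² min_{k≠k'} ‖θ_k - θ_k'‖² ≥ C (log K + log(σ̄²/σ̲²) + log(ᾱ/α̲))`. -/
def SepCond {L K : ℕ} (θs : Fin K → Vec L) (σlow σbar αlow αbar C : ℝ) : Prop :=
  ∀ k k' : Fin K, k ≠ k' →
    C * (Real.log (K : ℝ) + Real.log (σbar ^ 2 / σlow ^ 2) + Real.log (αbar / αlow))
      ≤ σlow ^ 2 * (nrm fun l => θs k l - θs k' l) ^ 2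


lemma nrm_nonneg' {L : ℕ} (v : Vec L) : 0 ≤ nrm v := Real.sqrt_nonneg _

lemma nrm_sq' {L : ℕ} (v : Vec L) : nrm v ^ 2 = ∑ l, (v l) ^ 2 :=
  Real.sq_sqrt (Finset.sum_nonneg fun _ _ => sq_nonneg _)

lemma nrm_eq_zero' {L : ℕ} (v : Vec L) (h : nrm v = 0) : v = 0 := by
  have h1 : ∑ l, (v l) ^ 2 = 0 := by rw [← nrm_sq', h]; norm_num
  rw [Finset.sum_eq_zero_iff_of_nonneg (fun _ _ => sq_nonneg _)] at h1
  funext l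
  exact pow_eq_zero_iff (two_ne_zero) |>.1 (h1 l (Finset.mem_univ l))

lemma dot_smul' {L : ℕ} (v w : Vec L) (c : ℝ) : dot v (fun l => c * w l) = c * dot v w := by
  unfold dot
  rw [Finset.mul_sum]
  exact Finset.sum_congr rfl fun _ _ => by ring

lemma abs_dot_le {L : ℕ} (v w : Vec L) : |dot v w| ≤ nrm v * nrm w := by
  apply abs_le_of_sq_le_sq _ (mul_nonneg (nrm_nonneg' v) (nrm_nonneg' w))
  rw [mul_pow, nrm_sq', nrm_sq']
  exact Finset.sum_mul_sq_le_sq_mul_sq _ _ _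

lemma sumexp_pos {p : ℕ} (hp : 0 < p) (c : Fin p → ℝ) : 0 < ∑ i, Real.exp (c i) :=
  Finset.sum_pos (fun _ _ => Real.exp_pos _) ⟨⟨0, hp⟩, Finset.mem_univ _⟩

lemma softA_pos {L p : ℕ} (hp : 0 < p) (x : Fin p → Vec L) (θ : Vec L) (j : Fin p) :
    0 < softA x θ j := div_pos (Real.exp_pos _) (sumexp_pos hp _)

lemma softA_sum {L p : ℕ} (hp : 0 < p) (x : Fin p → Vec L) (θ : Vec L) :
    ∑ j, softA x θ j = 1 := by
  unfold softA
  rw [← Finset.sum_div]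
  exact div_self (sumexp_pos hp _).ne'

lemma qH_smul {L p : ℕ} (x : Fin p → Vec L) (θ v : Vec L) (c : ℝ) :
    qH x θ (fun l => c * v l) = c ^ 2 * qH x θ v := by
  unfold qH qSecond
  simp only [dot_smul']
  rw [mul_sub, ← mul_pow, Finset.mul_sum, Finset.mul_sum]
  congr 1
  · exact Finset.sum_congr rfl fun _ _ => by ring
  · congr 1; exact Finset.sum_congr rfl fun _ _ => by ring

lemma qH_zero {L p : ℕ} (x : Fin p → Vec L) (θ : Vec L) : qH x θ 0 = 0 := by
  simp [qH, qSecond, dot]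

lemma qH_bounds {L p : ℕ} (x : Fin p → Vec L) (θ : Vec L) (lo hi : ℝ)
    (h : ∀ v : Vec L, nrm v = 1 → lo ≤ qH x θ v ∧ qH x θ v ≤ hi) (v : Vec L) :
    lo * nrm v ^ 2 ≤ qH x θ v ∧ qH x θ v ≤ hi * nrm v ^ 2 := by
  by_cases h0 : nrm v = 0
  · rw [nrm_eq_zero' v h0, qH_zero]
    have : nrm (0 : Vec L) = 0 := by simp [nrm]
    simp [this]
  · have hpos : 0 < nrm v ^ 2 := by positivity
    have hw : nrm (fun l => (nrm v)⁻¹ * v l) = 1 := by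
      have : nrm (fun l => (nrm v)⁻¹ * v l) ^ 2 = 1 := by
        rw [nrm_sq']
        simp only [mul_pow]
        rw [← Finset.mul_sum, ← nrm_sq']
        field_simp
      nlinarith [nrm_nonneg' (fun l => (nrm v)⁻¹ * v l)]
    have := h _ hw
    rw [qH_smul, inv_pow, inv_mul_eq_div] at this
    exact ⟨(le_div_iff₀ hpos).1 this.1, (div_le_iff₀ hpos).1 this.2⟩

/-- weighted second moment about a point -/
lemma second_moment {p : ℕ} (A y : Fin p → ℝ) (hA : ∑ j, A j = 1) (c : ℝ) :
    ∑ j, A j * (y j - c) ^ 2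
      = (∑ j, A j * y j ^ 2 - (∑ j, A j * y j) ^ 2) + ((∑ j, A j * y j) - c) ^ 2 := by
  have : ∀ j, A j * (y j - c) ^ 2 = A j * y j ^ 2 - 2 * c * (A j * y j) + c ^ 2 * A j :=
    fun j => by ring
  simp only [this]
  rw [Finset.sum_add_distrib, Finset.sum_sub_distrib, ← Finset.mul_sum, ← Finset.mul_sum, hA]
  ring

lemma double_var {p : ℕ} (A y : Fin p → ℝ) (hA : ∑ j, A j = 1) :
    ∑ i, ∑ j, A i * A j * (y i - y j) ^ 2
      = 2 * (∑ j, A j * y j ^ 2 - (∑ j, A j * y j) ^ 2) := by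
  have h1 : ∀ i, ∑ j, A i * A j * (y i - y j) ^ 2 = A i * ∑ j, A j * (y j - y i) ^ 2 := by
    intro i
    rw [Finset.mul_sum]
    exact Finset.sum_congr rfl fun _ _ => by ring
  simp only [h1, second_moment A y hA]
  have h2 : ∀ i, A i * ((∑ j, A j * y j ^ 2 - (∑ j, A j * y j) ^ 2) + ((∑ j, A j * y j) - y i) ^ 2)
      = (∑ j, A j * y j ^ 2 - (∑ j, A j * y j) ^ 2) * A i
        + A i * (y i - (∑ j, A j * y j)) ^ 2 := fun i => by ring
  simp only [h2]
  rw [Finset.sum_add_distrib, ← Finset.mul_sum, hA, second_moment A y hA]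
  ring

lemma cov_sq {p : ℕ} (A y z : Fin p → ℝ) (hA0 : ∀ j, 0 ≤ A j) (hA : ∑ j, A j = 1) :
    (∑ j, A j * (z j - ∑ i, A i * z i) * y j) ^ 2
      ≤ (∑ j, A j * y j ^ 2 - (∑ j, A j * y j) ^ 2)
        * (∑ j, A j * z j ^ 2 - (∑ j, A j * z j) ^ 2) := by
  set my := ∑ j, A j * y j with hmy
  set mz := ∑ j, A j * z j with hmz
  have h1 : ∑ j, A j * (z j - mz) * y j
      = ∑ j, (Real.sqrt (A j) * (y j - my)) * (Real.sqrt (A j) * (z j - mz)) := by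
    have e : ∀ j, (Real.sqrt (A j) * (y j - my)) * (Real.sqrt (A j) * (z j - mz))
        = A j * (z j - mz) * y j - my * (A j * z j) + my * mz * A j := by
      intro j
      have := Real.mul_self_sqrt (hA0 j)
      linear_combination (y j - my) * (z j - mz) * this
    simp only [e]
    rw [Finset.sum_add_distrib, Finset.sum_sub_distrib, ← Finset.mul_sum, ← Finset.mul_sum, hA,
      ← hmz]
    ring
  have e2 : ∀ y : Fin p → ℝ, ∑ j, A j * y j ^ 2 - (∑ j, A j * y j) ^ 2
      = ∑ j, (Real.sqrt (A j) * (y j - ∑ j, A j * y j)) ^ 2 := by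
    intro y
    have := second_moment A y hA (∑ j, A j * y j)
    rw [sub_self] at this
    rw [show ∑ j, A j * y j ^ 2 - (∑ j, A j * y j) ^ 2 = ∑ j, A j * (y j - ∑ j, A j * y j) ^ 2 by
      rw [this]; ring]
    exact Finset.sum_congr rfl fun j _ => by rw [mul_pow, Real.sq_sqrt (hA0 j)]
  rw [h1, hmy, hmz, e2 y, e2 z]
  exact Finset.sum_mul_sq_le_sq_mul_sq _ _ _

lemma dot_seg {L : ℕ} (x a b : Vec L) (u : ℝ) :
    dot x (seg a b u) = dot x b + u * dot x (fun l => a l - b l) := by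
  unfold dot seg
  rw [Finset.mul_sum, ← Finset.sum_add_distrib]
  exact Finset.sum_congr rfl fun _ _ => by ring

lemma hasDeriv_expseg {L : ℕ} (x a b : Vec L) (u : ℝ) :
    HasDerivAt (fun u => Real.exp (dot x (seg a b u)))
      (Real.exp (dot x (seg a b u)) * dot x (fun l => a l - b l)) u := by
  simp only [dot_seg]
  have := (((hasDerivAt_id u).mul_const (dot x (fun l => a l - b l))).const_add (dot x b)).exp
  simpa using this

lemma hasDeriv_logZ {L p : ℕ} (hp : 0 < p) (x : Fin p → Vec L) (a b : Vec L) (u : ℝ) :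
    HasDerivAt (fun u => Real.log (∑ i, Real.exp (dot (x i) (seg a b u))))
      (∑ j, softA x (seg a b u) j * dot (x j) (fun l => a l - b l)) u := by
  have h := (HasDerivAt.fun_sum (u := Finset.univ)
    (fun i _ => hasDeriv_expseg (x i) a b u)).log (sumexp_pos hp _).ne'
  convert h using 1
  rw [Finset.sum_div]
  exact Finset.sum_congr rfl fun _ _ => by unfold softA; ring

lemma hasDeriv_softA {L p : ℕ} (hp : 0 < p) (x : Fin p → Vec L) (a b : Vec L) (u : ℝ)
    (j : Fin p) :
    HasDerivAt (fun u => softA x (seg a b u) j)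
      (softA x (seg a b u) j * (dot (x j) (fun l => a l - b l)
        - ∑ i, softA x (seg a b u) i * dot (x i) (fun l => a l - b l))) u := by
  have hne := (sumexp_pos hp (fun i => dot (x i) (seg a b u))).ne'
  have h := (hasDeriv_expseg (x j) a b u).div (HasDerivAt.fun_sum (u := Finset.univ)
    (fun i _ => hasDeriv_expseg (x i) a b u)) hne
  refine HasDerivAt.congr_deriv h ?_
  have : ∑ i, softA x (seg a b u) i * dot (x i) (fun l => a l - b l)
     = (∑ i, Real.exp (dot (x i) (seg a b u)) * dot (x i) (fun l => a l - b l))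
       / ∑ i, Real.exp (dot (x i) (seg a b u)) := by
    rw [Finset.sum_div]
    exact Finset.sum_congr rfl fun _ _ => by unfold softA; ring
  rw [this]
  unfold softA
  field_simp

lemma hasDeriv_mean {L p : ℕ} (hp : 0 < p) (x : Fin p → Vec L) (a b v : Vec L) (u : ℝ) :
    HasDerivAt (fun u => ∑ j, softA x (seg a b u) j * dot (x j) v)
      (∑ j, softA x (seg a b u) j * (dot (x j) (fun l => a l - b l)
        - ∑ i, softA x (seg a b u) i * dot (x i) (fun l => a l - b l)) * dot (x j) v) u :=
  HasDerivAt.fun_sum (u := Finset.univ)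
    (fun j _ => (hasDeriv_softA hp x a b u j).mul_const (dot (x j) v))

lemma mean_diff {L p : ℕ} (hp : 0 < p) (x : Fin p → Vec L) (a b v : Vec L) (hi : ℝ) (h0 : 0 ≤ hi)
    (h : ∀ u ∈ Set.Icc (0:ℝ) 1, ∀ v, qH x (seg a b u) v ≤ hi * nrm v ^ 2) :
    ((∑ j, softA x (seg a b (1/2)) j * dot (x j) v) - ∑ j, softA x (seg a b 1) j * dot (x j) v) ^ 2
      ≤ hi ^ 2 * nrm v ^ 2 * nrm (fun l => a l - b l) ^ 2 / 4 := by
  set g : Vec L := fun l => a l - b l with hg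
  have hb : ∀ u ∈ Set.Icc (0:ℝ) 1, ‖∑ j, softA x (seg a b u) j * (dot (x j) g
        - ∑ i, softA x (seg a b u) i * dot (x i) g) * dot (x j) v‖ ≤ hi * nrm v * nrm g := by
    intro u hu
    rw [Real.norm_eq_abs]
    apply abs_le_of_sq_le_sq _ (by have := nrm_nonneg' v; have := nrm_nonneg' g; positivity)
    refine (cov_sq (softA x (seg a b u)) (fun j => dot (x j) v) (fun j => dot (x j) g)
      (fun j => (softA_pos hp x _ j).le) (softA_sum hp x _)).trans ?_
    have h1 := h u hu v
    have h2 := h u hu g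
    have h3 : 0 ≤ qH x (seg a b u) g := by
      have := second_moment (softA x (seg a b u)) (fun j => dot (x j) g) (softA_sum hp x _)
        (∑ j, softA x (seg a b u) j * dot (x j) g)
      rw [sub_self] at this
      unfold qH qSecond
      have h4 : 0 ≤ ∑ j, softA x (seg a b u) j * (dot (x j) g
         - (∑ j, softA x (seg a b u) j * dot (x j) g)) ^ 2 :=
        Finset.sum_nonneg fun j _ => mul_nonneg (softA_pos hp x _ j).le (sq_nonneg _)
      rw [this] at h4
      simpa using h4
    calc _ = qH x (seg a b u) v * qH x (seg a b u) g := rfl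
      _ ≤ (hi * nrm v ^ 2) * (hi * nrm g ^ 2) :=
        mul_le_mul h1 h2 h3 (by positivity)
      _ = _ := by ring
  have := (convex_Icc (0:ℝ) 1).norm_image_sub_le_of_norm_hasDerivWithin_le
    (fun u hu => (hasDeriv_mean hp x a b v u).hasDerivWithinAt) hb
    (show (1:ℝ) ∈ Set.Icc (0:ℝ) 1 by simp)
    (show (1/2:ℝ) ∈ Set.Icc (0:ℝ) 1 by constructor <;> norm_num)
  rw [Real.norm_eq_abs, Real.norm_eq_abs, show |(1/2:ℝ) - 1| = 1/2 by norm_num [abs_of_nonpos]] at this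
  have h5 := pow_le_pow_left₀ (abs_nonneg _) this 2
  rw [sq_abs] at h5
  refine h5.trans (le_of_eq ?_)
  ring

lemma logZ_mid {L p : ℕ} (hp : 0 < p) (x : Fin p → Vec L) (a b : Vec L) (s : ℝ)
    (h : ∀ u ∈ Set.Icc (0:ℝ) 1, s ≤ qH x (seg a b u) (fun l => a l - b l)) :
    Real.log (∑ i, Real.exp (dot (x i) (seg a b (1/2))))
      ≤ (Real.log (∑ i, Real.exp (dot (x i) (seg a b 0)))
         + Real.log (∑ i, Real.exp (dot (x i) (seg a b 1)))) / 2 - s / 8 := by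
  set g : Vec L := fun l => a l - b l with hg
  have hd1 : ∀ u, HasDerivAt (fun u => Real.log (∑ i, Real.exp (dot (x i) (seg a b u)))
      - s / 2 * u ^ 2) ((∑ j, softA x (seg a b u) j * dot (x j) g) - s * u) u := by
    intro u
    refine HasDerivAt.congr_deriv
      ((hasDeriv_logZ hp x a b u).sub ((hasDerivAt_pow 2 u).const_mul (s / 2))) ?_
    simp only [hg]; norm_num; ring
  have hd2 : ∀ u, HasDerivAt (fun u => (∑ j, softA x (seg a b u) j * dot (x j) g) - s * u)
      (qH x (seg a b u) g - s) u := by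
    intro u
    refine HasDerivAt.congr_deriv
      ((hasDeriv_mean hp x a b g u).sub ((hasDerivAt_id u).const_mul s)) ?_
    rw [mul_one]
    congr 1
    unfold qH qSecond
    have : ∀ m : ℝ, ∑ j, softA x (seg a b u) j * (dot (x j) g - m) * dot (x j) g
      = ∑ j, softA x (seg a b u) j * dot (x j) g ^ 2
        - m * ∑ j, softA x (seg a b u) j * dot (x j) g := by
      intro m
      rw [Finset.mul_sum, ← Finset.sum_sub_distrib]
      exact Finset.sum_congr rfl fun _ _ => by ring
    rw [← hg, this]; ring
  have hc := convexOn_of_hasDerivWithinAt2_nonneg (convex_Icc (0:ℝ) 1)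
    (f := fun u => Real.log (∑ i, Real.exp (dot (x i) (seg a b u))) - s / 2 * u ^ 2)
    (fun u _ => (hd1 u).continuousAt.continuousWithinAt)
    (fun u _ => (hd1 u).hasDerivWithinAt) (fun u _ => (hd2 u).hasDerivWithinAt)
    (fun u hu => by have := h u (interior_subset hu); linarith)
  have := hc.2 (show (0:ℝ) ∈ Set.Icc (0:ℝ) 1 by simp) (show (1:ℝ) ∈ Set.Icc (0:ℝ) 1 by simp)
    (show (0:ℝ) ≤ 1/2 by norm_num) (show (0:ℝ) ≤ 1/2 by norm_num) (by norm_num)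
  simp only [smul_eq_mul, mul_zero, zero_add, mul_one] at this
  linarith

lemma overlap {L p : ℕ} (hp : 0 < p) (x : Fin p → Vec L) (a b : Vec L) (s : ℝ)
    (h : ∀ u ∈ Set.Icc (0:ℝ) 1, s ≤ qH x (seg a b u) (fun l => a l - b l)) (j : Fin p) :
    Real.sqrt (softA x a j * softA x b j) ≤ Real.exp (-s / 8) * softA x (seg a b (1/2)) j := by
  have hl := logZ_mid hp x a b s h
  have e0 : seg a b 0 = b := by funext l; simp [seg]
  have e1 : seg a b 1 = a := by funext l; simp [seg]
  rw [e0, e1] at hl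
  have hsoft : ∀ θ, softA x θ j
      = Real.exp (dot (x j) θ - Real.log (∑ i, Real.exp (dot (x i) θ))) := by
    intro θ
    rw [Real.exp_sub, Real.exp_log (sumexp_pos hp _)]; rfl
  rw [hsoft, hsoft, hsoft, ← Real.exp_add, ← Real.exp_add, Real.sqrt_eq_rpow, ← Real.exp_mul]
  apply Real.exp_le_exp.2
  have hd : dot (x j) (seg a b (1/2)) = (dot (x j) a + dot (x j) b) / 2 := by
    unfold dot seg
    rw [← Finset.sum_add_distrib, Finset.sum_div]
    exact Finset.sum_congr rfl fun _ _ => by ring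
  rw [hd]
  linarith

lemma exp_lip (a b : ℝ) (ha : |a| ≤ 1) (hb : |b| ≤ 1) :
    (a - b) ^ 2 ≤ 9 * (Real.exp a - Real.exp b) ^ 2 ∧
    (Real.exp a - Real.exp b) ^ 2 ≤ 9 * (a - b) ^ 2 := by
  wlog hab : b ≤ a generalizing a b
  · have := this b a hb ha (le_of_not_ge hab)
    constructor <;> nlinarith
  have he : Real.exp a ≤ 3 := by
    have := Real.exp_one_lt_d9
    have := Real.exp_le_exp.2 (abs_le.1 ha).2
    linarith
  have hf : 1 / 3 ≤ Real.exp b := by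
    have h1 := Real.exp_one_lt_d9
    have h2 := Real.exp_le_exp.2 (abs_le.1 hb).1
    rw [Real.exp_neg] at h2
    have : (3:ℝ)⁻¹ ≤ (Real.exp 1)⁻¹ := inv_anti₀ (Real.exp_pos _) (by linarith)
    linarith
  have h1 : a - b ≤ 3 * (Real.exp a - Real.exp b) := by
    have := Real.add_one_le_exp (a - b)
    have h2 : Real.exp a = Real.exp b * Real.exp (a - b) := by rw [← Real.exp_add]; ring_nf
    nlinarith
  have h3 : Real.exp a - Real.exp b ≤ 3 * (a - b) := by
    have := Real.add_one_le_exp (b - a)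
    have h2 : Real.exp b = Real.exp a * Real.exp (b - a) := by rw [← Real.exp_add]; ring_nf
    nlinarith
  have h4 : 0 ≤ Real.exp a - Real.exp b := by
    have := Real.exp_le_exp.2 hab; linarith
  constructor <;> nlinarith

/-- variance of exponentials -/
lemma var_exp {p : ℕ} (A y : Fin p → ℝ) (hA0 : ∀ j, 0 ≤ A j) (hA : ∑ j, A j = 1)
    (hy : ∀ j, |y j| ≤ 1) :
    ∑ j, A j * y j ^ 2 - (∑ j, A j * y j) ^ 2
      ≤ 9 * (∑ j, A j * Real.exp (y j) ^ 2 - (∑ j, A j * Real.exp (y j)) ^ 2) := by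
  have h1 := double_var A y hA
  have h2 := double_var A (fun j => Real.exp (y j)) hA
  have : ∑ i, ∑ j, A i * A j * (y i - y j) ^ 2
    ≤ 9 * ∑ i, ∑ j, A i * A j * (Real.exp (y i) - Real.exp (y j)) ^ 2 := by
    rw [Finset.mul_sum]
    refine Finset.sum_le_sum fun i _ => ?_
    rw [Finset.mul_sum]
    refine Finset.sum_le_sum fun j _ => ?_
    have := mul_le_mul_of_nonneg_left (exp_lip _ _ (hy i) (hy j)).1
      (mul_nonneg (hA0 i) (hA0 j))
    linarith
  linarith

lemma exp_dev {p : ℕ} (A y : Fin p → ℝ) (hA0 : ∀ j, 0 ≤ A j) (hA : ∑ j, A j = 1)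
    (hy : ∀ j, |y j| ≤ 1) (j : Fin p) :
    (Real.exp (y j) - ∑ i, A i * Real.exp (y i)) ^ 2
      ≤ 9 * ((∑ j, A j * y j ^ 2 - (∑ j, A j * y j) ^ 2) + (y j - ∑ i, A i * y i) ^ 2) := by
  have h1 := second_moment A (fun j => Real.exp (y j)) hA (Real.exp (y j))
  have h2 := second_moment A y hA (y j)
  have h3 := second_moment A (fun j => Real.exp (y j)) hA (∑ i, A i * Real.exp (y i))
  have h4 : 0 ≤ ∑ k, A k * (Real.exp (y k) - ∑ i, A i * Real.exp (y i)) ^ 2 :=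
    Finset.sum_nonneg fun k _ => mul_nonneg (hA0 k) (sq_nonneg _)
  have h5 : ∑ k, A k * (Real.exp (y k) - Real.exp (y j)) ^ 2
      ≤ 9 * ∑ k, A k * (y k - y j) ^ 2 := by
    rw [Finset.mul_sum]
    refine Finset.sum_le_sum fun k _ => ?_
    have := mul_le_mul_of_nonneg_left (exp_lip _ _ (hy k) (hy j)).2 (hA0 k)
    linarith
  rw [sub_self] at h3
  have h6 : (y j - ∑ i, A i * y i) ^ 2 = ((∑ i, A i * y i) - y j) ^ 2 := by ring
  rw [h6]
  nlinarith

/-- exact formula for the norm of `P + Q e^y`. -/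
lemma fnorm {p : ℕ} (A y : Fin p → ℝ) (hA : ∑ j, A j = 1) (P Q : ℝ) :
    ∑ j, A j * (P + Q * Real.exp (y j)) ^ 2
      = (P + Q * ∑ j, A j * Real.exp (y j)) ^ 2
       + Q ^ 2 * (∑ j, A j * Real.exp (y j) ^ 2 - (∑ j, A j * Real.exp (y j)) ^ 2) := by
  have : ∀ j, A j * (P + Q * Real.exp (y j)) ^ 2 = P ^ 2 * A j + 2 * P * Q * (A j * Real.exp (y j))
     + Q ^ 2 * (A j * Real.exp (y j) ^ 2) := fun j => by ring
  simp only [this]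
  rw [Finset.sum_add_distrib, Finset.sum_add_distrib, ← Finset.mul_sum, ← Finset.mul_sum,
    ← Finset.mul_sum, hA]
  ring

lemma pointwise {K : ℕ} (a f : Fin K → ℝ) (ha : ∀ k, 0 < a k) (h : ∑ k, a k * f k = 0) :
    ∑ k, a k * f k ^ 2
      ≤ ∑ k, ∑ l, (if k = l then 0 else Real.sqrt (a k * a l) * f k ^ 2) := by
  by_cases hK : K = 0
  · subst hK; simp
  set T := ∑ k, a k with hT
  have hTpos : 0 < T :=
    Finset.sum_pos (fun k _ => ha k) ⟨⟨0, Nat.pos_of_ne_zero hK⟩, Finset.mem_univ _⟩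
  have key : ∑ k, ∑ l, a k * a l * (f k - f l) ^ 2 = 2 * (T * ∑ k, a k * f k ^ 2) := by
    have e : ∀ k, ∑ l, a k * a l * (f k - f l) ^ 2
        = T * (a k * f k ^ 2) + a k * ∑ l, a l * f l ^ 2 := by
      intro k
      have : ∀ l, a k * a l * (f k - f l) ^ 2
        = a k * f k ^ 2 * a l - 2 * a k * f k * (a l * f l) + a k * (a l * f l ^ 2) :=
          fun l => by ring
      simp only [this]
      rw [Finset.sum_add_distrib, Finset.sum_sub_distrib, ← Finset.mul_sum, ← Finset.mul_sum,
        ← Finset.mul_sum, h]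
      ring
    simp only [e]
    rw [Finset.sum_add_distrib, ← Finset.mul_sum, ← Finset.sum_mul]
    ring
  set W := ∑ k, ∑ l, (if k = l then 0 else Real.sqrt (a k * a l) * f k ^ 2) with hW
  have hW' : W = ∑ k, ∑ l, (if k = l then 0 else Real.sqrt (a k * a l) * f l ^ 2) := by
    rw [hW, Finset.sum_comm]
    refine Finset.sum_congr rfl fun k _ => Finset.sum_congr rfl fun l _ => ?_
    by_cases hkl : k = l
    · simp [hkl]
    · rw [if_neg hkl, if_neg (Ne.symm hkl), mul_comm (a l)]
  have bd : ∑ k, ∑ l, a k * a l * (f k - f l) ^ 2 ≤ T * (W + W) := by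
    nth_rewrite 2 [hW']
    rw [hW, ← Finset.sum_add_distrib, Finset.mul_sum]
    refine Finset.sum_le_sum fun k _ => ?_
    rw [← Finset.sum_add_distrib, Finset.mul_sum]
    refine Finset.sum_le_sum fun l _ => ?_
    by_cases hkl : k = l
    · simp [hkl]
    rw [if_neg hkl, if_neg hkl]
    have hkT : a k + a l ≤ T := by
      rw [hT, ← Finset.sum_pair hkl]
      exact Finset.sum_le_sum_of_subset_of_nonneg (Finset.subset_univ _) fun i _ _ => (ha i).le
    set r := Real.sqrt (a k * a l) with hr
    have hr0 : 0 ≤ r := Real.sqrt_nonneg _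
    have hr2 : r ^ 2 = a k * a l := Real.sq_sqrt (mul_pos (ha k) (ha l)).le
    have h2r : 2 * r ≤ T := by
      have : 2 * r ≤ a k + a l := by
        apply le_of_sq_le_sq _ (add_pos (ha k) (ha l)).le
        nlinarith [sq_nonneg (a k - a l)]
      linarith
    have h3 : a k * a l * 2 ≤ T * r := by rw [← hr2]; nlinarith
    have h4 : (f k - f l) ^ 2 ≤ 2 * (f k ^ 2 + f l ^ 2) := by nlinarith [sq_nonneg (f k + f l)]
    calc a k * a l * (f k - f l) ^ 2 ≤ a k * a l * (2 * (f k ^ 2 + f l ^ 2)) :=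
          mul_le_mul_of_nonneg_left h4 (mul_pos (ha k) (ha l)).le
      _ = (a k * a l * 2) * (f k ^ 2 + f l ^ 2) := by ring
      _ ≤ (T * r) * (f k ^ 2 + f l ^ 2) := mul_le_mul_of_nonneg_right h3 (by positivity)
      _ = _ := by ring
  rw [key] at bd
  have : T * (∑ k, a k * f k ^ 2) ≤ T * W := by linarith
  exact le_of_mul_le_mul_left this hTpos

set_option maxHeartbeats 2000000 in
lemma cross {L p : ℕ} (hp : 0 < p) (x : Fin p → Vec L) (a b Δ : Vec L) (σlow σbar : ℝ)
    (h0 : 0 < σlow) (h1 : σlow ≤ σbar)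
    (h : ∀ u ∈ Set.Icc (0:ℝ) 1, ∀ v, σlow ^ 2 * nrm v ^ 2 ≤ qH x (seg a b u) v ∧
      qH x (seg a b u) v ≤ σbar ^ 2 * nrm v ^ 2)
    (hy : ∀ j, |dot (x j) Δ| ≤ 1) (P Q : ℝ) :
    ∑ j, Real.sqrt (softA x a j * softA x b j) * (P + Q * Real.exp (dot (x j) Δ)) ^ 2
      ≤ 648 * (σbar ^ 2 / σlow ^ 2) ^ 2 *
          Real.exp (-(σlow ^ 2 * nrm (fun l => a l - b l) ^ 2) / 16)
        * ∑ j, softA x a j * (P + Q * Real.exp (dot (x j) Δ)) ^ 2 := by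
  set D := nrm (fun l => a l - b l) with hD
  set s := σlow ^ 2 * D ^ 2 with hs
  have hs0 : 0 ≤ s := by positivity
  set A := softA x a with hA
  set B := softA x (seg a b (1/2)) with hB
  set y : Fin p → ℝ := fun j => dot (x j) Δ with hyd
  have e1 : seg a b 1 = a := by funext l; simp [seg]
  have hA0 : ∀ j, 0 ≤ A j := fun j => (softA_pos hp x _ j).le
  have hB0 : ∀ j, 0 ≤ B j := fun j => (softA_pos hp x _ j).le
  have hA1 : ∑ j, A j = 1 := softA_sum hp x _
  have hB1 : ∑ j, B j = 1 := softA_sum hp x _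
  have hov := overlap hp x a b s (fun u hu => (h u hu _).1)
  have hmean := mean_diff hp x a b Δ (σbar ^ 2) (by positivity) (fun u hu v => (h u hu v).2)
  rw [e1] at hmean
  have hVA := (h 1 (by simp) Δ)
  rw [e1] at hVA
  have hVB := (h (1/2) (by constructor <;> norm_num) Δ)
  set N := nrm Δ with hN
  set ρ := σbar ^ 2 / σlow ^ 2 with hρ
  have hρ1 : 1 ≤ ρ := by
    rw [hρ, one_le_div (by positivity)]
    exact pow_le_pow_left₀ h0.le h1 2
  have hσ : σbar ^ 2 = ρ * σlow ^ 2 := by rw [hρ]; field_simp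
  set VA := ∑ j, A j * y j ^ 2 - (∑ j, A j * y j) ^ 2 with hVAd
  set VB := ∑ j, B j * y j ^ 2 - (∑ j, B j * y j) ^ 2 with hVBd
  change σlow ^ 2 * N ^ 2 ≤ VA ∧ VA ≤ _ at hVA
  change _ ≤ VB ∧ VB ≤ σbar ^ 2 * N ^ 2 at hVB
  set VE := ∑ j, A j * Real.exp (y j) ^ 2 - (∑ j, A j * Real.exp (y j)) ^ 2 with hVE
  set M := ∑ j, A j * Real.exp (y j) with hM
  have hve : VA ≤ 9 * VE := var_exp A y hA0 hA1 hy
  change ((∑ j, B j * y j) - ∑ j, A j * y j) ^ 2 ≤ _ at hmean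
  have hVA0 : 0 ≤ VA := le_trans (by positivity) hVA.1
  have hVE0 : 0 ≤ VE := by linarith
  have hfn : ∑ j, A j * (P + Q * Real.exp (y j)) ^ 2 = (P + Q * M) ^ 2 + Q ^ 2 * VE :=
    fnorm A y hA1 P Q
  -- pointwise bound
  have hpt : ∀ j, (P + Q * Real.exp (y j)) ^ 2
      ≤ 2 * (P + Q * M) ^ 2 + 18 * Q ^ 2 * VA
        + 18 * Q ^ 2 * (y j - ∑ i, A i * y i) ^ 2 := by
    intro j
    have h2 := exp_dev A y hA0 hA1 hy j
    have h3 : (P + Q * Real.exp (y j)) ^ 2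
        ≤ 2 * (P + Q * M) ^ 2 + 2 * Q ^ 2 * (Real.exp (y j) - M) ^ 2 := by
      nlinarith [sq_nonneg ((P + Q * M) - Q * (Real.exp (y j) - M))]
    have h4 := mul_le_mul_of_nonneg_left h2 (show 0 ≤ 2 * Q ^ 2 by positivity)
    linarith
  have hsumB : ∑ j, B j * (P + Q * Real.exp (y j)) ^ 2
      ≤ 2 * (P + Q * M) ^ 2 + 18 * Q ^ 2 * VA
        + 18 * Q ^ 2 * (VB + ((∑ j, B j * y j) - ∑ i, A i * y i) ^ 2) := by
    calc ∑ j, B j * (P + Q * Real.exp (y j)) ^ 2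
        ≤ ∑ j, B j * (2 * (P + Q * M) ^ 2 + 18 * Q ^ 2 * VA
        + 18 * Q ^ 2 * (y j - ∑ i, A i * y i) ^ 2) :=
          Finset.sum_le_sum fun j _ => mul_le_mul_of_nonneg_left (hpt j) (hB0 j)
      _ = ∑ j, ((2 * (P + Q * M) ^ 2 + 18 * Q ^ 2 * VA) * B j
            + 18 * Q ^ 2 * (B j * (y j - ∑ i, A i * y i) ^ 2)) :=
          Finset.sum_congr rfl fun _ _ => by ring
      _ = _ := by
        rw [Finset.sum_add_distrib, ← Finset.mul_sum, ← Finset.mul_sum, hB1, second_moment B y hB1]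
        ring
  have hVB2 : VB ≤ ρ * VA := by
    calc VB ≤ σbar ^ 2 * N ^ 2 := hVB.2
      _ = ρ * (σlow ^ 2 * N ^ 2) := by rw [hσ]; ring
      _ ≤ ρ * VA := mul_le_mul_of_nonneg_left hVA.1 (by linarith)
  have hmean2 : ((∑ j, B j * y j) - ∑ j, A j * y j) ^ 2 ≤ ρ ^ 2 * s / 4 * VA := by
    calc _ ≤ _ := hmean
      _ = ρ ^ 2 * s / 4 * (σlow ^ 2 * N ^ 2) := by rw [hσ, hs]; ring
      _ ≤ _ := mul_le_mul_of_nonneg_left hVA.1 (by positivity)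
  have hρ2 : ρ ≤ ρ ^ 2 := by nlinarith
  have hexp : 2 + s / 4 ≤ 4 * Real.exp (s / 16) := by
    have := Real.add_one_le_exp (s / 16); linarith
  have htot : ∑ j, B j * (P + Q * Real.exp (y j)) ^ 2
      ≤ 162 * ρ ^ 2 * (2 + s / 4) * ((P + Q * M) ^ 2 + Q ^ 2 * VE) := by
    have t1 : VA + (VB + ((∑ j, B j * y j) - ∑ i, A i * y i) ^ 2) ≤ ρ ^ 2 * (2 + s / 4) * (9 * VE) := by
      calc _ ≤ ρ ^ 2 * (2 + s / 4) * VA := by nlinarith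
        _ ≤ _ := mul_le_mul_of_nonneg_left hve (by positivity)
    have t2 := mul_le_mul_of_nonneg_left t1 (show 0 ≤ 18 * Q ^ 2 by positivity)
    have t3 : 2 * (P + Q * M) ^ 2 ≤ 162 * ρ ^ 2 * (2 + s / 4) * (P + Q * M) ^ 2 := by
      apply mul_le_mul_of_nonneg_right _ (sq_nonneg _)
      nlinarith
    linarith
  have hfin0 : 0 ≤ (P + Q * M) ^ 2 + Q ^ 2 * VE := by positivity
  change ∑ j, Real.sqrt (softA x a j * softA x b j) * (P + Q * Real.exp (y j)) ^ 2
      ≤ 648 * ρ ^ 2 * Real.exp (-s / 16) * ∑ j, A j * (P + Q * Real.exp (y j)) ^ 2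
  rw [hfn]
  calc ∑ j, Real.sqrt (softA x a j * softA x b j) * (P + Q * Real.exp (y j)) ^ 2
      ≤ ∑ j, (Real.exp (-s / 8) * B j) * (P + Q * Real.exp (y j)) ^ 2 :=
        Finset.sum_le_sum fun j _ => mul_le_mul_of_nonneg_right (hov j) (sq_nonneg _)
    _ = Real.exp (-s / 8) * ∑ j, B j * (P + Q * Real.exp (y j)) ^ 2 := by
        rw [Finset.mul_sum]; exact Finset.sum_congr rfl fun _ _ => by ring
    _ ≤ Real.exp (-s / 8) * (162 * ρ ^ 2 * (4 * Real.exp (s / 16)) * ((P + Q * M) ^ 2 + Q ^ 2 * VE)) := by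
        refine mul_le_mul_of_nonneg_left (htot.trans ?_) (Real.exp_pos _).le
        exact mul_le_mul_of_nonneg_right
          (mul_le_mul_of_nonneg_left hexp (by positivity)) hfin0
    _ = 648 * ρ ^ 2 * (Real.exp (-s / 8) * Real.exp (s / 16)) * ((P + Q * M) ^ 2 + Q ^ 2 * VE) := by ring
    _ = _ := by rw [← Real.exp_add]; ring_nf

lemma eta_small (K : ℕ) (hK : 2 ≤ K) (ρ s lg : ℝ) (hρ : 1 ≤ ρ) (hlg : 0 ≤ lg)
    (h : 224 * (Real.log K + Real.log ρ + lg) ≤ s) :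
    648 * ρ ^ 2 * Real.exp (-s / 16) * K ≤ 1 / 2 := by
  have hK' : (2:ℝ) ≤ K := by exact_mod_cast hK
  set R : ℝ := K * ρ with hR
  have hR2 : 2 ≤ R := by nlinarith
  have hlog : Real.log R = Real.log K + Real.log ρ :=
    Real.log_mul (by positivity) (by positivity)
  have h1 : Real.exp (-s / 16) ≤ (R ^ 14)⁻¹ := by
    have : -s / 16 ≤ -(14 * Real.log R) := by rw [hlog]; linarith
    calc _ ≤ Real.exp (-(14 * Real.log R)) := Real.exp_le_exp.2 this
      _ = _ := by
        rw [Real.exp_neg, show (14:ℝ) * Real.log R = Real.log (R ^ 14) by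
          rw [Real.log_pow]; norm_num, Real.exp_log (by positivity)]
  have h2 : ρ ^ 2 * K ≤ R ^ 2 := by rw [hR]; nlinarith [sq_nonneg ρ]
  have h3 : (2:ℝ) ^ 12 ≤ R ^ 12 := pow_le_pow_left₀ (by norm_num) hR2 12
  have hR0 : 0 < R := by linarith
  calc 648 * ρ ^ 2 * Real.exp (-s / 16) * K = 648 * (ρ ^ 2 * K) * Real.exp (-s / 16) := by ring
    _ ≤ 648 * R ^ 2 * (R ^ 14)⁻¹ := by
      apply mul_le_mul _ h1 (Real.exp_pos _).le (by positivity)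
      linarith
    _ = 648 / R ^ 12 := by field_simp
    _ ≤ 1 / 2 := by
      rw [div_le_iff₀ (by positivity)]
      norm_num at h3
      linarith

lemma softA_shift {L p : ℕ} (hp : 0 < p) (x : Fin p → Vec L) (θ φ : Vec L) (j : Fin p) :
    softA x φ j = softA x θ j * (Real.exp (dot (x j) (fun l => φ l - θ l))
      / ∑ i, softA x θ i * Real.exp (dot (x i) (fun l => φ l - θ l))) := by
  have hd : ∀ i, dot (x i) φ = dot (x i) θ + dot (x i) (fun l => φ l - θ l) := by
    intro i
    unfold dot
    rw [← Finset.sum_add_distrib]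
    exact Finset.sum_congr rfl fun _ _ => by ring
  have hz := sumexp_pos hp (fun i => dot (x i) θ)
  have hz2 := sumexp_pos hp (fun i => dot (x i) φ)
  have : ∑ i, softA x θ i * Real.exp (dot (x i) (fun l => φ l - θ l))
      = (∑ i, Real.exp (dot (x i) φ)) / ∑ i, Real.exp (dot (x i) θ) := by
    rw [Finset.sum_div]
    refine Finset.sum_congr rfl fun i _ => ?_
    rw [hd i, Real.exp_add]; unfold softA; ring
  rw [this]
  unfold softA
  rw [hd j, Real.exp_add]
  field_simp

/-- Corollary 1 (local identifiability): under Assumption 1, if `ω₁*, ω₂* ∈ Ω*` induce the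
same softmax mixture, both satisfy the separation condition with a sufficiently large
absolute constant `C`, and `d(ω₁*, ω₂*) ≤ δ₀/2` with `δ₀ ≤ c₀ σ̄/(ς² ‖𝐗‖_{∞,2})` for a
sufficiently small `c₀ ∈ [0,1/2)`, then `ω₁* = ω₂*`. -/
theorem local_identifiability :
    ∃ C : ℝ, 0 < C ∧ ∃ c0 : ℝ, 0 < c0 ∧ c0 < 1 / 2 ∧
      ∀ (L p K : ℕ), 0 < L → 0 < p → 0 < K →
      ∀ (x : Fin p → Vec L) (ωtrue : Param L K) (σlow σbar ς αlow αbar : ℝ),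
        0 < σlow → σlow ≤ σbar → 0 < ς → 0 < αlow → αlow < 1 → 0 < αbar → αbar < 1 →
        Simplex ωtrue.a →
        Assumption1 x ωtrue σlow σbar ς →
        ∀ ω1 ∈ OmegaStar x ωtrue, ∀ ω2 ∈ OmegaStar x ωtrue,
          (∀ j, mixP x ω1 j = mixP x ω2 j) →
          (∀ k, αlow ≤ ω1.a k ∧ ω1.a k ≤ αbar) →
          (∀ k, αlow ≤ ω2.a k ∧ ω2.a k ≤ αbar) →
          SepCond ω1.t σlow σbar αlow αbar C →
          SepCond ω2.t σlow σbar αlow αbar C →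
          ∀ δ0 : ℝ, 0 ≤ δ0 → δ0 ≤ c0 / ς ^ 2 * (σbar / Xnorm x) →
            dParam σbar αlow ω1 ω2 ≤ δ0 / 2 →
            ω1 = ω2 := by
  refine ⟨224, by norm_num, 1 / 4, by norm_num, by norm_num, ?_⟩
  intro L p K hL hp hK x ωtrue σlow σbar ς αlow αbar hσ0 hσ1 hς hαl _ hαb hαb1 _ hA1
    ω1 hω1 ω2 hω2 hmix ha1 ha2 hsep _ δ0 hδ0 hδ hd
  have hσb : 0 < σbar := lt_of_lt_of_le hσ0 hσ1
  -- K ≥ 2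
  have hK2 : 2 ≤ K := by
    by_contra hcon
    have hK1 : K = 1 := by omega
    subst hK1
    have h1 := hω1.1.2
    rw [Fin.sum_univ_one] at h1
    have := (ha1 0).2
    linarith
  have hbd : ∀ a b : Fin K, ∀ u ∈ Set.Icc (0:ℝ) 1, ∀ v,
      σlow ^ 2 * nrm v ^ 2 ≤ qH x (seg (ω1.t a) (ω1.t b) u) v ∧
      qH x (seg (ω1.t a) (ω1.t b) u) v ≤ σbar ^ 2 * nrm v ^ 2 := fun a b u hu =>
    qH_bounds x _ _ _ fun v hv => ⟨(hA1 ω1 hω1 a b u hu v hv).1, (hA1 ω1 hω1 a b u hu v hv).2.1⟩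
  -- ς ≥ 1
  have hς1 : 1 ≤ ς ^ 2 := by
    let e : Vec L := fun l => if l = ⟨0, hL⟩ then 1 else 0
    have he : nrm e = 1 := by simp [nrm, e]
    have h := hA1 ω1 hω1 ⟨0, hK⟩ ⟨0, hK⟩ 0 (by simp) e he
    set θ := seg (ω1.t ⟨0, hK⟩) (ω1.t ⟨0, hK⟩) 0
    have h1 : qH x θ e ≤ qSecond x θ e := by unfold qH; nlinarith [sq_nonneg (∑ j, softA x θ j * dot (x j) e)]
    have h2 : 0 < σlow ^ 2 := by positivity
    by_contra hcon
    push Not at hcon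
    nlinarith [h.1, h.2.1, h.2.2]
  let Δ : Fin K → Vec L := fun k l => ω2.t k l - ω1.t k l
  have hX : ∀ j, nrm (x j) ≤ Xnorm x := fun j =>
    le_ciSup (f := fun j => nrm (x j)) (Set.finite_range _).bddAbove j
  have hy : ∀ k j, |dot (x j) (Δ k)| ≤ 1 := by
    intro k j
    have hN : nrm (Δ k) ≤ ⨆ k, nrm fun l => ω1.t k l - ω2.t k l := by
      have : nrm (Δ k) = nrm fun l => ω1.t k l - ω2.t k l := by
        unfold nrm
        congr 1
        exact Finset.sum_congr rfl fun l _ => by simp only [Δ]; ring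
      rw [this]
      exact le_ciSup (f := fun k => nrm fun l => ω1.t k l - ω2.t k l)
        (Set.finite_range _).bddAbove k
    have h1 : σbar * nrm (Δ k) ≤ δ0 / 2 :=
      (mul_le_mul_of_nonneg_left hN hσb.le).trans ((le_max_left _ _).trans hd)
    have hX0 : 0 ≤ Xnorm x := (nrm_nonneg' _).trans (hX j)
    have h2 : δ0 * Xnorm x ≤ σbar := by
      rcases hX0.eq_or_lt with h0 | h0
      · rw [← h0]; linarith
      · have h3 : (1 / 4 / ς ^ 2 : ℝ) ≤ 1 := by
          rw [div_le_one (by positivity)]; linarith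
        have h4 : δ0 ≤ σbar / Xnorm x :=
          hδ.trans (mul_le_of_le_one_left (by positivity) h3)
        exact (le_div_iff₀ h0).1 h4
    refine (abs_dot_le _ _).trans ?_
    have h5 : nrm (x j) * nrm (Δ k) ≤ Xnorm x * nrm (Δ k) :=
      mul_le_mul_of_nonneg_right (hX j) (nrm_nonneg' _)
    have h6 : σbar * (Xnorm x * nrm (Δ k)) ≤ σbar * 1 := by nlinarith
    exact h5.trans (le_of_mul_le_mul_left h6 hσb)
  let M : Fin K → ℝ := fun k => ∑ i, softA x (ω1.t k) i * Real.exp (dot (x i) (Δ k))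
  have hM : ∀ k, 0 < M k := fun k => Finset.sum_pos
    (fun i _ => mul_pos (softA_pos hp x _ i) (Real.exp_pos _)) ⟨⟨0, hp⟩, Finset.mem_univ _⟩
  let f : Fin K → Fin p → ℝ := fun k j =>
    -ω1.a k + ω2.a k / M k * Real.exp (dot (x j) (Δ k))
  have hzero : ∀ j, ∑ k, softA x (ω1.t k) j * f k j = 0 := by
    intro j
    have h1 := hmix j
    unfold mixP at h1
    have h2 : ∀ k, softA x (ω1.t k) j * f k j
        = ω2.a k * softA x (ω2.t k) j - ω1.a k * softA x (ω1.t k) j := by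
      intro k
      rw [softA_shift hp x (ω1.t k) (ω2.t k) j]
      simp only [f, M, Δ]
      ring
    simp only [h2]
    rw [Finset.sum_sub_distrib, h1, sub_self]
  have hρ1 : 1 ≤ σbar ^ 2 / σlow ^ 2 := by
    rw [one_le_div (by positivity)]
    exact pow_le_pow_left₀ hσ0.le hσ1 2
  have hlg : 0 ≤ Real.log (αbar / αlow) := by
    apply Real.log_nonneg
    rw [one_le_div hαl]
    exact (ha1 ⟨0, hK⟩).1.trans (ha1 ⟨0, hK⟩).2
  have hKpos : (0:ℝ) < K := by exact_mod_cast hK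
  let N : Fin K → ℝ := fun k => ∑ j, softA x (ω1.t k) j * f k j ^ 2
  have hN0 : ∀ k, 0 ≤ N k := fun k =>
    Finset.sum_nonneg fun j _ => mul_nonneg (softA_pos hp x _ j).le (sq_nonneg _)
  have hcross : ∀ k l, k ≠ l →
      ∑ j, Real.sqrt (softA x (ω1.t k) j * softA x (ω1.t l) j) * f k j ^ 2
        ≤ 1 / (2 * K) * N k := by
    intro k l hkl
    refine (cross hp x (ω1.t k) (ω1.t l) (Δ k) σlow σbar hσ0 hσ1 (hbd k l) (hy k)
      (-ω1.a k) (ω2.a k / M k)).trans ?_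
    refine mul_le_mul_of_nonneg_right ?_ (hN0 k)
    have := eta_small K hK2 _ _ _ hρ1 hlg (hsep k l hkl)
    rw [show (1:ℝ) / (2 * K) = 1 / 2 / K by field_simp, le_div_iff₀ hKpos]
    exact this
  have hsum : ∑ k, N k ≤ 1 / 2 * ∑ k, N k := by
    calc ∑ k, N k = ∑ j, ∑ k, softA x (ω1.t k) j * f k j ^ 2 := Finset.sum_comm
      _ ≤ ∑ j, ∑ k, ∑ l, (if k = l then 0 else
            Real.sqrt (softA x (ω1.t k) j * softA x (ω1.t l) j) * f k j ^ 2) :=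
          Finset.sum_le_sum fun j _ => pointwise (fun k => softA x (ω1.t k) j) (fun k => f k j)
            (fun k => softA_pos hp x _ j) (hzero j)
      _ = ∑ k, ∑ l, ∑ j, (if k = l then 0 else
            Real.sqrt (softA x (ω1.t k) j * softA x (ω1.t l) j) * f k j ^ 2) := by
          rw [Finset.sum_comm]
          exact Finset.sum_congr rfl fun k _ => Finset.sum_comm
      _ ≤ ∑ k, ∑ _l : Fin K, 1 / (2 * K) * N k := by
          refine Finset.sum_le_sum fun k _ => Finset.sum_le_sum fun l _ => ?_
          by_cases hkl : k = l
          · simp only [hkl, if_true, Finset.sum_const_zero]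
            have := hN0 l
            positivity
          · simp only [if_neg hkl]
            exact hcross k l hkl
      _ = 1 / 2 * ∑ k, N k := by
          rw [Finset.mul_sum]
          refine Finset.sum_congr rfl fun k _ => ?_
          rw [Finset.sum_const, Finset.card_univ, Fintype.card_fin, nsmul_eq_mul]
          field_simp
  have hNz : ∀ k, N k = 0 := by
    have h1 : ∑ k, N k = 0 :=
      le_antisymm (by linarith) (Finset.sum_nonneg fun k _ => hN0 k)
    rw [Finset.sum_eq_zero_iff_of_nonneg (fun k _ => hN0 k)] at h1
    exact fun k => h1 k (Finset.mem_univ k)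
  have hfin : ∀ k, ω1.a k = ω2.a k ∧ ω1.t k = ω2.t k := by
    intro k
    have hs1 := softA_sum hp x (ω1.t k)
    have h1 : N k = (-ω1.a k + ω2.a k / M k * M k) ^ 2 + (ω2.a k / M k) ^ 2 *
        (∑ j, softA x (ω1.t k) j * Real.exp (dot (x j) (Δ k)) ^ 2 - (M k) ^ 2) :=
      fnorm (softA x (ω1.t k)) (fun j => dot (x j) (Δ k)) hs1 _ _
    have h2 := var_exp (softA x (ω1.t k)) (fun j => dot (x j) (Δ k))
      (fun j => (softA_pos hp x _ j).le) hs1 (hy k)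
    have h3 := (hbd k k 1 (by simp) (Δ k)).1
    rw [show seg (ω1.t k) (ω1.t k) 1 = ω1.t k by funext l; simp [seg]] at h3
    have h4 : qH x (ω1.t k) (Δ k) ≤ 9 * (∑ j, softA x (ω1.t k) j *
      Real.exp (dot (x j) (Δ k)) ^ 2 - (M k) ^ 2) := h2
    set V := ∑ j, softA x (ω1.t k) j * Real.exp (dot (x j) (Δ k)) ^ 2 - (M k) ^ 2 with hV
    have hn : 0 ≤ σlow ^ 2 * nrm (Δ k) ^ 2 := by positivity
    have hV0 : 0 ≤ V := by linarith
    have hQ : 0 < ω2.a k / M k := div_pos (hαl.trans_le (ha2 k).1) (hM k)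
    rw [hNz k, div_mul_cancel₀ _ (hM k).ne'] at h1
    have hQV : 0 ≤ (ω2.a k / M k) ^ 2 * V := by positivity
    have h5 : (-ω1.a k + ω2.a k) ^ 2 = 0 := by nlinarith [sq_nonneg (-ω1.a k + ω2.a k)]
    have h6 : (ω2.a k / M k) ^ 2 * V = 0 := by nlinarith [sq_nonneg (-ω1.a k + ω2.a k)]
    have h7 : V = 0 := (mul_eq_zero.1 h6).resolve_left (by positivity)
    have h8 : σlow ^ 2 * nrm (Δ k) ^ 2 = 0 := by linarith
    have h9 : nrm (Δ k) = 0 :=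
      pow_eq_zero_iff two_ne_zero |>.1 ((mul_eq_zero.1 h8).resolve_left (by positivity))
    have h10 := nrm_eq_zero' _ h9
    refine ⟨?_, ?_⟩
    · have := pow_eq_zero_iff two_ne_zero |>.1 h5
      linarith
    · funext l
      have h11 := congrFun h10 l
      simp only [Δ, Pi.zero_apply] at h11
      linarith
  cases ω1 with
  | mk a1 t1 =>
    cases ω2 with
    | mk a2 t2 =>
      have e1 : a1 = a2 := funext fun k => (hfin k).1
      have e2 : t1 = t2 := funext fun k => (hfin k).2
      rw [e1, e2]

end SM
end
end

section
/- Let ρ* = ∑_{k=1}^K α_k* δ_{θ_k*} be a K-atomic measure on ℝ^L with all α_k* > 0, ∑_k α_k* = 1, and distinct first coordinates θ_{11}*,…,θ_{1K}*. Then the system of equations m_r = ∑_k α_k (θ_{1k})^r (0 ≤ r ≤ 2K−1) and m_{r1;i} = ∑_k α_k (θ_{1k})^r θ_{ik} (0 ≤ r ≤ K−1, 2 ≤ i ≤ L) has a unique solution equal to (α*, θ_1*,…,θ_K*) up to relabeling. Explicitly: (1) θ_{11}*,…,θ_{1K}* are the K roots of the degree-K polynomial P(x) = det of the (K+1)×(K+1)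 matrix whose r-th row (0 ≤ r ≤ K−1) is (m_r, m_{r+1},…, m_{r+K}) with m_0 = 1 and whose last row is (1, x, …, x^K); (2) for 2 ≤ i ≤ L and k ∈ [K], θ_{ik}* = (m_{01;i},…,m_{(K−1)1;i}) M^{−1} (1, θ_{1k}*, …, (θ_{1k}*)^{K−1})^⊤, where M is the K×K Hankel matrix with (a,b) entry m_{a+b−2}; (3) α* = V^{−1}(1, m_1, …, m_{K−1})^⊤, where V is the K×K Vandermonde matrix with (a,b) entry (θ_{1b}*)^{a−1}. -/
open scoped BigOperators

noncomputable section
namespace SM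

/-- Latent moments `m_r = ∑_k α_k θ_{1k}^r` of the first coordinate. -/
def mom {K : ℕ} (α : Fin K → ℝ) (θ1 : Fin K → ℝ) (r : ℕ) : ℝ :=
  ∑ k, α k * θ1 k ^ r

/-- Latent mixed moments `m_{r1;i} = ∑_k α_k θ_{1k}^r θ_{ik}`. -/
def mixedMom {K : ℕ} (α : Fin K → ℝ) (θ1 θi : Fin K → ℝ) (r : ℕ) : ℝ :=
  ∑ k, α k * θ1 k ^ r * θi k

/-- The `(K+1) × (K+1)` matrix whose determinant is the polynomial `P(x)`:
row `r` (for `0 ≤ r ≤ K-1`) is `(m_r, m_{r+1}, …, m_{r+K})` and the last row is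
`(1, x, …, x^K)`. -/
def Pmat {K : ℕ} (α : Fin K → ℝ) (θ1 : Fin K → ℝ) (y : ℝ) :
    Matrix (Fin (K + 1)) (Fin (K + 1)) ℝ :=
  fun r c => if (r : ℕ) < K then mom α θ1 ((r : ℕ) + (c : ℕ)) else y ^ (c : ℕ)

/-- The `K × K` Hankel moment matrix with `(a,b)` entry `m_{a+b}` (`0`-indexed). -/
def hankel {K : ℕ} (α : Fin K → ℝ) (θ1 : Fin K → ℝ) : Matrix (Fin K) (Fin K) ℝ :=
  fun a b => mom α θ1 ((a : ℕ) + (b : ℕ))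

/-- The `K × K` Vandermonde matrix with `(a,b)` entry `θ_{1b}^a` (`0`-indexed). -/
def vand {K : ℕ} (θ1 : Fin K → ℝ) : Matrix (Fin K) (Fin K) ℝ :=
  fun a b => θ1 b ^ (a : ℕ)

lemma key {K : ℕ} {α x w : Fin K → ℝ} (hα : ∀ k, 0 < α k) (hx : Function.Injective x)
    (h : ∀ r : Fin K, ∑ k, α k * x k ^ (r : ℕ) * w k = 0) (k : Fin K) : w k = 0 := by
  have h2 : (fun k => α k * w k) = 0 := by
    apply Matrix.eq_zero_of_forall_pow_sum_mul_pow_eq_zero hx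
    intro r
    rw [← h r]
    exact Finset.sum_congr rfl fun k _ => by ring
  have := congrFun h2 k
  simpa [(hα k).ne'] using this

lemma keyT {K : ℕ} {x v : Fin K → ℝ} (hx : Function.Injective x)
    (h : ∀ k : Fin K, ∑ c, v c * x k ^ (c : ℕ) = 0) : v = 0 :=
  Matrix.eq_zero_of_forall_index_sum_mul_pow_eq_zero hx (by
    intro j
    exact h j)

lemma sum_swap {K n : ℕ} (α x : Fin K → ℝ) (v : Fin n → ℝ) (r : ℕ) :
    ∑ c : Fin n, mom α x (r + (c : ℕ)) * v c = ∑ k, α k * x k ^ r * ∑ c, v c * x k ^ (c : ℕ) := by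
  simp only [mom, Finset.sum_mul, Finset.mul_sum]
  rw [Finset.sum_comm]
  exact Finset.sum_congr rfl fun k _ => Finset.sum_congr rfl fun c _ => by ring

lemma hankel_det {K : ℕ} {α x : Fin K → ℝ} (hα : ∀ k, 0 < α k) (hx : Function.Injective x) :
    (hankel α x).det ≠ 0 := by
  intro h0
  obtain ⟨v, hv, h⟩ := Matrix.exists_mulVec_eq_zero_iff.mpr h0
  apply hv
  apply keyT hx
  apply key hα hx
  intro r
  rw [← sum_swap]
  exact congrFun h r

lemma P_roots {K : ℕ} {α x : Fin K → ℝ} (hα : ∀ k, 0 < α k) (hx : Function.Injective x) (y : ℝ) :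
    (Pmat α x y).det = 0 ↔ ∃ k, y = x k := by
  constructor
  · intro h0
    obtain ⟨v, hv, h⟩ := Matrix.exists_mulVec_eq_zero_iff.mpr h0
    by_contra! hy
    apply hv
    have hinj : Function.Injective (Fin.snoc x y : Fin (K + 1) → ℝ) :=
      Fin.snoc_injective_iff.mpr ⟨hx, by rintro ⟨k, hk⟩; exact hy k hk.symm⟩
    apply keyT hinj
    intro k
    refine Fin.lastCases ?_ (fun k => ?_) k
    · have := congrFun h (Fin.last K)
      simp only [Matrix.mulVec, dotProduct, Pmat, Fin.val_last, lt_irrefl, if_false,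
        Pi.zero_apply] at this
      simp only [Fin.snoc_last]
      rw [← this]
      exact Finset.sum_congr rfl fun c _ => by ring
    · simp only [Fin.snoc_castSucc]
      revert k
      apply key hα hx
      intro r
      rw [← sum_swap]
      have := congrFun h r.castSucc
      simpa [Matrix.mulVec, dotProduct, Pmat] using this
  · rintro ⟨k, rfl⟩
    have h0 : (Matrix.vandermonde (Fin.snoc x (x k) : Fin (K + 1) → ℝ)).det = 0 := by
      rw [Matrix.det_vandermonde_eq_zero_iff]
      refine ⟨k.castSucc, Fin.last K, by simp, ?_⟩
      exact (Fin.castSucc_lt_last k).ne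
    obtain ⟨v, hv, h⟩ := Matrix.exists_mulVec_eq_zero_iff.mpr h0
    have hk : ∀ j, ∑ c, v c * x j ^ (c : ℕ) = 0 := by
      intro j
      have := congrFun h j.castSucc
      simp only [Matrix.mulVec, dotProduct, Matrix.vandermonde_apply, Fin.snoc_castSucc,
        Pi.zero_apply] at this
      rw [← this]
      exact Finset.sum_congr rfl fun c _ => by ring
    refine Matrix.exists_mulVec_eq_zero_iff.mp ⟨v, hv, ?_⟩
    funext r
    simp only [Matrix.mulVec, dotProduct, Pmat, Pi.zero_apply]
    by_cases hr : (r : ℕ) < K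
    · simp only [hr, if_true]
      rw [sum_swap]
      simp [hk]
    · simp only [hr, if_false]
      rw [← hk k]
      exact Finset.sum_congr rfl fun c _ => by ring

lemma poly_mixed {K n : ℕ} {β ψ s α θ t : Fin K → ℝ}
    (h : ∀ r < n, mixedMom β ψ s r = mixedMom α θ t r) (p : Polynomial ℝ)
    (hp : p.natDegree < n) :
    ∑ k, β k * p.eval (ψ k) * s k = ∑ k, α k * p.eval (θ k) * t k := by
  have H : ∀ (β ψ s : Fin K → ℝ), ∑ k, β k * p.eval (ψ k) * s k =
      ∑ r ∈ Finset.range n, p.coeff r * mixedMom β ψ s r := by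
    intro β ψ s
    simp only [mixedMom, Polynomial.eval_eq_sum_range' hp, Finset.mul_sum, Finset.sum_mul]
    rw [Finset.sum_comm]
    exact Finset.sum_congr rfl fun k _ => Finset.sum_congr rfl fun c _ => by ring
  rw [H, H]
  exact Finset.sum_congr rfl fun r hr => by rw [h r (Finset.mem_range.mp hr)]

lemma mom_eq {K : ℕ} (α θ : Fin K → ℝ) (r : ℕ) : mom α θ r = mixedMom α θ (fun _ => 1) r := by
  simp [mom, mixedMom]

open Polynomial in
/-- The polynomial vanishing at all nodes but the `j`-th. -/
def lag {K : ℕ} (ψ : Fin K → ℝ) (j : Fin K) : Polynomial ℝ :=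
  ∏ l ∈ Finset.univ.erase j, (X - C (ψ l))

lemma lag_deg {K : ℕ} (ψ : Fin K → ℝ) (j : Fin K) : (lag ψ j).natDegree = K - 1 := by
  simp [lag, Polynomial.natDegree_prod_of_monic _ _ fun i _ => Polynomial.monic_X_sub_C (ψ i)]

lemma lag_ne {K : ℕ} {ψ : Fin K → ℝ} (hψ : Function.Injective ψ) (j : Fin K) :
    (lag ψ j).eval (ψ j) ≠ 0 := by
  simp only [lag, Polynomial.eval_prod, Finset.prod_ne_zero_iff]
  intro l hl
  have := Finset.ne_of_mem_erase hl
  simpa [sub_eq_zero] using fun h => this (hψ h).symm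

lemma lag_zero {K : ℕ} (ψ : Fin K → ℝ) {j k : Fin K} (h : k ≠ j) :
    (lag ψ j).eval (ψ k) = 0 := by
  simp only [lag, Polynomial.eval_prod]
  exact Finset.prod_eq_zero (Finset.mem_erase.mpr ⟨h, Finset.mem_univ k⟩) (by simp)

open Polynomial in
lemma nodes {K : ℕ} {β ψ α θ : Fin K → ℝ} (hβ : ∀ k, 0 < β k)
    (hψ : Function.Injective ψ)
    (h : ∀ r < 2 * K, mom β ψ r = mom α θ r) (j : Fin K) : ∃ k, ψ j = θ k := by
  have hK : 0 < K := j.pos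
  set Q : ℝ[X] := ∏ l, (X - C (θ l)) with hQ
  have hQd : Q.natDegree = K := by
    simp [hQ, Polynomial.natDegree_prod_of_monic _ _ fun i _ => Polynomial.monic_X_sub_C (θ i)]
  have h0 := poly_mixed (s := fun _ => 1) (t := fun _ => 1) (n := 2 * K) (β := β) (ψ := ψ) (α := α)
    (θ := θ) (fun r hr => by rw [← mom_eq, ← mom_eq, h r hr]) (Q * lag ψ j)
    (lt_of_le_of_lt Polynomial.natDegree_mul_le (by rw [hQd, lag_deg]; omega))
  have hz : ∀ k, Q.eval (θ k) = 0 := fun k => by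
    rw [hQ, Polynomial.eval_prod]
    exact Finset.prod_eq_zero (Finset.mem_univ k) (by simp)
  rw [Finset.sum_eq_single j (fun k _ hk => by simp [lag_zero ψ hk]) (by simp)] at h0
  have : Q.eval (ψ j) = 0 := by
    simpa [hz, (hβ j).ne', lag_ne hψ j] using h0
  rw [hQ, Polynomial.eval_prod, Finset.prod_eq_zero_iff] at this
  obtain ⟨k, _, hk⟩ := this
  exact ⟨k, by simpa [sub_eq_zero] using hk⟩

lemma match_one {K : ℕ} {β ψ s α θ t : Fin K → ℝ} (hψ : Function.Injective ψ)
    (e : Equiv.Perm (Fin K)) (he : ∀ k, ψ k = θ (e k))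
    (h : ∀ r < K, mixedMom β ψ s r = mixedMom α θ t r) (j : Fin K) :
    β j * s j = α (e j) * t (e j) := by
  have hK : 0 < K := j.pos
  have h0 := poly_mixed h (lag ψ j) (by rw [lag_deg]; omega)
  rw [← Equiv.sum_comp e (fun k => α k * (lag ψ j).eval (θ k) * t k)] at h0
  simp only [← he] at h0
  rw [Finset.sum_eq_single j (fun k _ hk => by simp [lag_zero ψ hk]) (by simp),
    Finset.sum_eq_single j (fun k _ hk => by simp [lag_zero ψ hk]) (by simp)] at h0
  apply mul_right_cancel₀ (lag_ne hψ j)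
  linarith

/-- Lemma (Lindsay): for a `K`-atomic measure `ρ* = ∑ α_k* δ_{θ_k*}` on `ℝ^L` with
positive weights and distinct first coordinates, the moment equations determine the
parameters uniquely up to relabeling; moreover the first coordinates are exactly the
roots of the Hankel-determinant polynomial `P`, the remaining coordinates are given by
the Hankel-inverse formula, and the weights by the Vandermonde-inverse formula. -/
theorem lindsay_moment_determinacy :
    ∀ (L K : ℕ) (hL : 0 < L) (hK : 0 < K)
      (αs : Fin K → ℝ) (θs : Fin K → Vec L),
      (∀ k, 0 < αs k) → (∑ k, αs k = 1) →
      Function.Injective (fun k => θs k ⟨0, hL⟩) →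
      -- uniqueness up to label switching
      (∀ (β : Fin K → ℝ) (ψ : Fin K → Vec L),
        (∀ k, 0 < β k) →
        Function.Injective (fun k => ψ k ⟨0, hL⟩) →
        (∀ r : ℕ, r ≤ 2 * K - 1 →
          mom β (fun k => ψ k ⟨0, hL⟩) r = mom αs (fun k => θs k ⟨0, hL⟩) r) →
        (∀ r : ℕ, r ≤ K - 1 → ∀ i : Fin L, i ≠ ⟨0, hL⟩ →
          mixedMom β (fun k => ψ k ⟨0, hL⟩) (fun k => ψ k i) r =
            mixedMom αs (fun k => θs k ⟨0, hL⟩) (fun k => θs k i) r) →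
        ∃ e : Equiv.Perm (Fin K), ∀ k, β k = αs (e k) ∧ ψ k = θs (e k)) ∧
      -- (1) the first coordinates are exactly the roots of `P`
      (∀ y : ℝ,
        Matrix.det (Pmat αs (fun k => θs k ⟨0, hL⟩) y) = 0 ↔ ∃ k, y = θs k ⟨0, hL⟩) ∧
      -- (2) the remaining coordinates via the Hankel inverse
      (∀ i : Fin L, i ≠ ⟨0, hL⟩ → ∀ k : Fin K,
        θs k i = ∑ a : Fin K, ∑ b : Fin K,
          mixedMom αs (fun k' => θs k' ⟨0, hL⟩) (fun k' => θs k' i) (a : ℕ) *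
            (hankel αs (fun k' => θs k' ⟨0, hL⟩))⁻¹ a b * θs k ⟨0, hL⟩ ^ (b : ℕ)) ∧
      -- (3) the weights via the Vandermonde inverse
      (∀ k : Fin K,
        αs k = ∑ b : Fin K,
          (vand (fun k' => θs k' ⟨0, hL⟩))⁻¹ k b *
            mom αs (fun k' => θs k' ⟨0, hL⟩) (b : ℕ)) := by
  intro L K hL hK αs θs hα hsum hθ
  refine ⟨?_, P_roots hα hθ, ?_, ?_⟩
  · intro β ψ hβ hψ hm hmm
    have hn := nodes (α := αs) (θ := fun k => θs k ⟨0, hL⟩) hβ hψ (fun r hr => hm r (by omega))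
    choose f hf using hn
    have hfi : Function.Injective f := fun a b hab => hψ (by
      show ψ a ⟨0, hL⟩ = ψ b ⟨0, hL⟩
      have h1 := hf a
      have h2 := hf b
      rw [h1, h2, hab])
    let e : Equiv.Perm (Fin K) := Equiv.ofBijective f (Finite.injective_iff_bijective.mp hfi)
    have hw : ∀ k, β k = αs (e k) := fun k => by
      have := match_one (s := fun _ => 1) (t := fun _ => 1) (β := β) (α := αs)
        (θ := fun k => θs k ⟨0, hL⟩) hψ e hf
        (fun r hr => by rw [← mom_eq, ← mom_eq, hm r (by omega)]) k
      simpa using this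
    refine ⟨e, fun k => ⟨hw k, ?_⟩⟩
    funext i
    by_cases hi : i = ⟨0, hL⟩
    · rw [hi]; exact hf k
    · have := match_one (β := β) (α := αs) (θ := fun k => θs k ⟨0, hL⟩) hψ e hf
        (fun r hr => hmm r (by omega) i hi) k
      rw [hw k] at this
      exact mul_left_cancel₀ (hα (e k)).ne' this
  · intro i _ k
    set x : Fin K → ℝ := fun k' => θs k' ⟨0, hL⟩ with hxdef
    set t : Fin K → ℝ := fun k' => θs k' i with ht
    set M := hankel αs x with hM
    have hdet : IsUnit M.det := (hankel_det hα hθ).isUnit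
    set m : Fin K → ℝ := fun a => mixedMom αs x t (a : ℕ) with hm
    set u := Matrix.vecMul m M⁻¹ with hu
    have huM : Matrix.vecMul u M = m := by
      rw [hu, Matrix.vecMul_vecMul, Matrix.nonsing_inv_mul _ hdet, Matrix.vecMul_one]
    have hk := key (w := fun k => (∑ c, u c * x k ^ (c : ℕ)) - t k) hα hθ (by
      intro r
      have h1 := congrFun huM r
      simp only [mul_sub, Finset.sum_sub_distrib]
      rw [sub_eq_zero]
      refine Eq.trans ?_ h1
      have h2 := sum_swap αs x u r
      refine h2.symm.trans ?_
      simp only [Matrix.vecMul, dotProduct, hM, hankel]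
      exact Finset.sum_congr rfl fun c _ => by rw [mul_comm, add_comm]) k
    have h3 : t k = ∑ c, u c * x k ^ (c : ℕ) := by linarith
    refine h3.trans ?_
    rw [Finset.sum_comm]
    refine Finset.sum_congr rfl fun c _ => ?_
    simp only [hu, Matrix.vecMul, dotProduct, Finset.sum_mul]
    rfl
  · intro k
    set x : Fin K → ℝ := fun k' => θs k' ⟨0, hL⟩ with hxdef
    have hV : vand x = (Matrix.vandermonde x).transpose := by
      ext a b; simp [vand, Matrix.vandermonde_apply]
    have hdet : IsUnit (vand x).det := by
      rw [hV, Matrix.det_transpose]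
      exact (Matrix.det_vandermonde_ne_zero_iff.mpr hθ).isUnit
    have hm : Matrix.mulVec (vand x) αs = fun b : Fin K => mom αs x (b : ℕ) := by
      funext b
      simp only [Matrix.mulVec, dotProduct, vand, mom]
      exact Finset.sum_congr rfl fun c _ => mul_comm _ _
    have h1 : Matrix.mulVec (vand x)⁻¹ (fun b : Fin K => mom αs x (b : ℕ)) = αs := by
      rw [← hm, Matrix.mulVec_mulVec, Matrix.nonsing_inv_mul _ hdet, Matrix.one_mulVec]
    exact (congrFun h1 k).symm

end SM
end
end

section
/- Let μ be a strictly positive C^∞ probability density on ℝ^L whose moment generating function is finite everywhere and whose mixed partial derivatives of all orders decay super-exponentially at infinity, and let X ∼ μ. For r ∈ ℕ, i ∈ {2,…,L} and x ∈ ℝ^L define h_r(x) = (−1)^r μ(x)^{−1} (d^r/dt^r) μ(x + t e_1)|_{t=0} and h_{r1;i}(x) = (−1)^{r+1} μ(x)^{−1} (d^{r+1}/(dt^r ds)) μ(x + t e_1 + s e_i)|_{t,s=0}, where e_1,…,e_L are the canonical basis vectors. Then for every θ ∈ ℝ^L: 𝔼_μ[h_r(X) exp(X^⊤θ)] / 𝔼_μ[exp(X^⊤θ)]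 = θ_1^r and 𝔼_μ[h_{r1;i}(X) exp(X^⊤θ)] / 𝔼_μ[exp(X^⊤θ)] = θ_1^r θ_i. -/
open scoped BigOperators
open MeasureTheory

noncomputable section
namespace SM

/-- Canonical basis vector `e_i` of `ℝ^L`. -/
def basisV (L : ℕ) (i : Fin L) : Vec L := fun l => if l = i then 1 else 0

/-- Assumption 2: `μ` is a strictly positive `C^∞` probability density on `ℝ^L` whose
moment generating function is finite everywhere and whose (iterated) derivatives of all
orders decay super-exponentially at infinity. -/
def SmoothDensity {L : ℕ} (μd : Vec L → ℝ) : Prop :=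
  (∀ x, 0 < μd x) ∧
  ContDiff ℝ (⊤ : ℕ∞) μd ∧
  (∫ x : Vec L, μd x = 1) ∧
  (∀ θ : Vec L, Integrable fun x : Vec L => Real.exp (dot x θ) * μd x) ∧
  (∀ n : ℕ, ∀ a : ℝ, 0 < a → ∃ Cn : ℝ, ∀ x : Vec L,
    ‖iteratedFDeriv ℝ n μd x‖ ≤ Cn * Real.exp (-a * ‖x‖))

/-- The function `h_r(x) = (-1)^r μ(x)⁻¹ (d^r/dt^r) μ(x + t v)|_{t=0}` (with `v = e_1`). -/
def hfun {L : ℕ} (μd : Vec L → ℝ) (r : ℕ) (v : Vec L) (x : Vec L) : ℝ :=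
  (-1 : ℝ) ^ r / μd x * iteratedDeriv r (fun t : ℝ => μd (x + t • v)) 0

/-- The function
`h_{r1;i}(x) = (-1)^{r+1} μ(x)⁻¹ (d^{r+1}/(dt^r ds)) μ(x + t v + s w)|_{t,s=0}`
(with `v = e_1`, `w = e_i`). -/
def hmix {L : ℕ} (μd : Vec L → ℝ) (r : ℕ) (v w : Vec L) (x : Vec L) : ℝ :=
  (-1 : ℝ) ^ (r + 1) / μd x *
    iteratedDeriv r (fun t : ℝ => deriv (fun s : ℝ => μd (x + t • v + s • w)) 0) 0

/-- directional derivative -/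
def DD {L : ℕ} (v : Vec L) (f : Vec L → ℝ) : Vec L → ℝ := fun x => fderiv ℝ f x v

/-- smooth with super-exponential decay -/
def Good {L : ℕ} (f : Vec L → ℝ) : Prop :=
  ContDiff ℝ (⊤ : ℕ∞) f ∧
  (∀ n : ℕ, ∀ a : ℝ, 0 < a → ∃ Cn : ℝ, ∀ x : Vec L,
    ‖iteratedFDeriv ℝ n f x‖ ≤ Cn * Real.exp (-a * ‖x‖))

lemma Good.dd {L : ℕ} {f : Vec L → ℝ} (hf : Good f) (v : Vec L) : Good (DD v f) := by
  have h1 : ContDiff ℝ (⊤ : ℕ∞) (fderiv ℝ f) := hf.1.fderiv_right (by simp)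
  refine ⟨h1.clm_apply contDiff_const, fun n a ha => ?_⟩
  obtain ⟨C, hC⟩ := hf.2 (n + 1) a ha
  refine ⟨‖v‖ * C, fun x => ?_⟩
  have h2 : ‖iteratedFDeriv ℝ n (DD v f) x‖ ≤ ‖v‖ * ‖iteratedFDeriv ℝ n (fderiv ℝ f) x‖ :=
    norm_iteratedFDeriv_clm_apply_const (N := (⊤ : ℕ∞)) h1.contDiffAt (by exact_mod_cast le_top)
  rw [norm_iteratedFDeriv_fderiv] at h2
  rw [mul_assoc]
  exact h2.trans (mul_le_mul_of_nonneg_left (hC x) (norm_nonneg _))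

lemma Good.iter {L : ℕ} {f : Vec L → ℝ} (hf : Good f) (v : Vec L) (r : ℕ) :
    Good ((DD v)^[r] f) := by
  induction r generalizing f with
  | zero => exact hf
  | succ n ih => exact ih (hf.dd v)

lemma hasDeriv_line {L : ℕ} {f : Vec L → ℝ} (hf : Good f) (x v : Vec L) (t : ℝ) :
    HasDerivAt (fun t : ℝ => f (x + t • v)) (DD v f (x + t • v)) t := by
  have h1 : HasFDerivAt f (fderiv ℝ f (x + t • v)) (x + t • v) :=
    ((hf.1.differentiable (by simp)) _).hasFDerivAt
  have h2 : HasDerivAt (fun t : ℝ => x + t • v) v t := by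
    simpa using ((hasDerivAt_id t).smul_const v).const_add x
  exact h1.comp_hasDerivAt t h2

lemma iter_line {L : ℕ} {f : Vec L → ℝ} (hf : Good f) (x v : Vec L) (r : ℕ) (t : ℝ) :
    iteratedDeriv r (fun t : ℝ => f (x + t • v)) t = (DD v)^[r] f (x + t • v) := by
  induction r generalizing f with
  | zero => simp
  | succ n ih =>
    rw [iteratedDeriv_succ']
    have : deriv (fun t : ℝ => f (x + t • v)) = fun t : ℝ => DD v f (x + t • v) :=
      funext fun t => (hasDeriv_line hf x v t).deriv
    rw [this, ih (hf.dd v)]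
    rfl

lemma integrable_exp_neg_norm' (L : ℕ) : Integrable fun x : Vec L => Real.exp (-‖x‖) := by
  have h := (integrable_one_add_norm (E := Vec L) (μ := volume) (r := (L : ℝ) + 1) (by simp)).const_mul
    ((L + 1).factorial * Real.exp 1)
  refine h.mono' (by fun_prop) (Filter.Eventually.of_forall fun x => ?_)
  have hp : 0 < 1 + ‖x‖ := by positivity
  have h1 := Real.pow_div_factorial_le_exp (1 + ‖x‖) hp.le (L + 1)
  have h2 : (1 + ‖x‖) ^ (-((L : ℝ) + 1)) = ((1 + ‖x‖) ^ (L + 1))⁻¹ := by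
    rw [Real.rpow_neg hp.le]
    congr 1
    exact_mod_cast Real.rpow_natCast (1 + ‖x‖) (L + 1)
  rw [h2, Real.norm_eq_abs, abs_of_pos (Real.exp_pos _), Real.exp_neg, ← div_eq_mul_inv,
    le_div_iff₀ (by positivity), inv_mul_le_iff₀ (Real.exp_pos _)]
  rw [div_le_iff₀ (by positivity), Real.exp_add] at h1
  linarith

lemma dot_le {L : ℕ} (x θ : Vec L) : dot x θ ≤ (∑ l, |θ l|) * ‖x‖ := by
  unfold dot
  rw [Finset.sum_mul]
  refine Finset.sum_le_sum fun l _ => ?_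
  calc x l * θ l ≤ |x l * θ l| := le_abs_self _
    _ = |θ l| * |x l| := by rw [abs_mul, mul_comm]
    _ ≤ _ := mul_le_mul_of_nonneg_left (norm_le_pi_norm x l) (abs_nonneg _)

lemma continuous_dot {L : ℕ} (θ : Vec L) : Continuous fun x : Vec L => dot x θ := by
  unfold dot; fun_prop

lemma Good.integrable {L : ℕ} {f : Vec L → ℝ} (hf : Good f) (θ : Vec L) :
    Integrable fun x : Vec L => Real.exp (dot x θ) * f x := by
  set K := ∑ l, |θ l| with hK
  have hK0 : 0 ≤ K := Finset.sum_nonneg fun l _ => abs_nonneg _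
  obtain ⟨C, hC⟩ := hf.2 0 (K + 1) (by linarith)
  have hc : Continuous fun x : Vec L => Real.exp (dot x θ) * f x :=
    (Real.continuous_exp.comp (continuous_dot θ)).mul hf.1.continuous
  refine ((integrable_exp_neg_norm' L).const_mul C).mono' hc.aestronglyMeasurable
    (Filter.Eventually.of_forall fun x => ?_)
  have h1 := hC x
  rw [norm_iteratedFDeriv_zero] at h1
  rw [norm_mul, Real.norm_eq_abs, abs_of_pos (Real.exp_pos _)]
  calc Real.exp (dot x θ) * ‖f x‖ ≤ Real.exp (K * ‖x‖) * (C * Real.exp (-(K + 1) * ‖x‖)) :=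
        mul_le_mul (Real.exp_le_exp.2 (dot_le x θ)) h1 (norm_nonneg _) (Real.exp_pos _).le
    _ = C * (Real.exp (K * ‖x‖) * Real.exp (-(K + 1) * ‖x‖)) := by ring
    _ = C * Real.exp (-‖x‖) := by rw [← Real.exp_add]; ring_nf

/-- dot as a clm -/
def dotL {L : ℕ} (θ : Vec L) : Vec L →L[ℝ] ℝ :=
  ∑ l, θ l • (ContinuousLinearMap.proj l : Vec L →L[ℝ] ℝ)

lemma dotL_apply {L : ℕ} (θ x : Vec L) : dotL θ x = dot x θ := by
  simp [dotL, dot, mul_comm]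

lemma ibp {L : ℕ} {f : Vec L → ℝ} (hf : Good f) (θ v : Vec L) :
    ∫ x, Real.exp (dot x θ) * DD v f x = - dot v θ * ∫ x, Real.exp (dot x θ) * f x := by
  have hd : ∀ x, HasFDerivAt (fun x : Vec L => Real.exp (dot x θ))
      (Real.exp (dot x θ) • dotL θ) x := by
    intro x
    have := (dotL θ).hasFDerivAt (x := x)
    simpa only [dotL_apply] using this.exp
  have hfd : ∀ x, fderiv ℝ (fun x : Vec L => Real.exp (dot x θ)) x v
      = Real.exp (dot x θ) * dot v θ := by
    intro x
    rw [(hd x).fderiv]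
    simp [dotL_apply]
  have h := integral_mul_fderiv_eq_neg_fderiv_mul_of_integrable (μ := volume) (𝕜 := ℝ)
    (f := fun x : Vec L => Real.exp (dot x θ)) (g := f) (v := v)
    (by simp only [hfd]
        refine ((hf.integrable θ).const_mul (dot v θ)).congr (Filter.Eventually.of_forall fun x => ?_)
        simp only []; ring)
    ((hf.dd v).integrable θ) (hf.integrable θ)
    (fun x _ => (hd x).differentiableAt) (fun x _ => hf.1.differentiable (by simp) x)
  simp only [hfd] at h
  unfold DD
  rw [h, neg_mul, ← integral_const_mul]
  congr 1
  refine integral_congr_ae (Filter.Eventually.of_forall fun x => ?_)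
  simp only []; ring

lemma ibp_iter {L : ℕ} {f : Vec L → ℝ} (hf : Good f) (θ v : Vec L) (r : ℕ) :
    ∫ x, Real.exp (dot x θ) * (DD v)^[r] f x =
      (- dot v θ) ^ r * ∫ x, Real.exp (dot x θ) * f x := by
  induction r with
  | zero => simp
  | succ n ih =>
    rw [Function.iterate_succ_apply', ibp (hf.iter v n), ih]
    ring

lemma dot_basis {L : ℕ} (i : Fin L) (θ : Vec L) : dot (basisV L i) θ = θ i := by
  simp [dot, basisV]

/-- Proposition 1: for `X ∼ μ` with `μ` satisfying Assumption 2, for every `θ ∈ ℝ^L`,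
`𝔼_μ[h_r(X) e^{Xᵀθ}]/𝔼_μ[e^{Xᵀθ}] = θ_1^r` and
`𝔼_μ[h_{r1;i}(X) e^{Xᵀθ}]/𝔼_μ[e^{Xᵀθ}] = θ_1^r θ_i`. -/
theorem latent_moment_functionals :
    ∀ (L : ℕ) (hL : 0 < L) (μd : Vec L → ℝ), SmoothDensity μd →
    ∀ (θ : Vec L) (r : ℕ),
      (∫ x : Vec L, hfun μd r (basisV L ⟨0, hL⟩) x * Real.exp (dot x θ) * μd x) /
          (∫ x : Vec L, Real.exp (dot x θ) * μd x) = θ ⟨0, hL⟩ ^ r ∧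
      ∀ i : Fin L, i ≠ ⟨0, hL⟩ →
        (∫ x : Vec L, hmix μd r (basisV L ⟨0, hL⟩) (basisV L i) x *
            Real.exp (dot x θ) * μd x) /
          (∫ x : Vec L, Real.exp (dot x θ) * μd x) = θ ⟨0, hL⟩ ^ r * θ i := by
  intro L hL μd hμ θ r
  obtain ⟨hpos, hsm, -, hint, hdec⟩ := hμ
  have hg : Good μd := ⟨hsm, hdec⟩
  have hZ : 0 < ∫ x : Vec L, Real.exp (dot x θ) * μd x := by
    have hp : ∀ x, 0 < Real.exp (dot x θ) * μd x := fun x => mul_pos (Real.exp_pos _) (hpos x)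
    rw [integral_pos_iff_support_of_nonneg (fun x => (hp x).le) (hint θ)]
    have : Function.support (fun x : Vec L => Real.exp (dot x θ) * μd x) = Set.univ :=
      Set.eq_univ_of_forall fun x => (hp x).ne'
    rw [this]
    exact Measure.measure_univ_pos.2 (NeZero.ne _)
  refine ⟨?_, fun i _ => ?_⟩
  · rw [div_eq_iff hZ.ne']
    have : ∀ x, hfun μd r (basisV L ⟨0, hL⟩) x * Real.exp (dot x θ) * μd x =
        (-1) ^ r * (Real.exp (dot x θ) * (DD (basisV L ⟨0, hL⟩))^[r] μd x) := by
      intro x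
      have := (hpos x).ne'
      unfold hfun
      rw [iter_line hg]
      simp only [zero_smul, add_zero]
      field_simp
    simp only [this]
    rw [integral_const_mul, ibp_iter hg, dot_basis, ← mul_assoc, ← mul_pow]
    simp
  · rw [div_eq_iff hZ.ne']
    have : ∀ x, hmix μd r (basisV L ⟨0, hL⟩) (basisV L i) x * Real.exp (dot x θ) * μd x =
        (-1) ^ (r + 1) * (Real.exp (dot x θ) *
          (DD (basisV L ⟨0, hL⟩))^[r] (DD (basisV L i) μd) x) := by
      intro x
      have := (hpos x).ne'
      unfold hmix
      have hin : (fun t : ℝ => deriv (fun s : ℝ =>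
          μd (x + t • basisV L ⟨0, hL⟩ + s • basisV L i)) 0) =
          fun t : ℝ => DD (basisV L i) μd (x + t • basisV L ⟨0, hL⟩) := by
        funext t
        rw [(hasDeriv_line hg _ _ _).deriv]
        simp
      rw [hin, iter_line (hg.dd _)]
      simp only [zero_smul, add_zero]
      field_simp
    simp only [this]
    rw [integral_const_mul, ibp_iter (hg.dd _), ibp hg, dot_basis, dot_basis, pow_succ,
      neg_pow (θ _) r]
    have h1 : ((-1 : ℝ) ^ r) * (-1) ^ r = 1 := by rw [← mul_pow]; simp
    linear_combination (θ ⟨0, hL⟩ ^ r * θ i * ∫ x : Vec L, Real.exp (dot x θ) * μd x) * h1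

end SM
end
end

section
/- For any integer p ≥ 1 and any (nonrandom) points x_1,…,x_p ∈ ℝ^L, there do not exist real numbers β_1,…,β_p such that ∑_{j=1}^p β_j exp(x_j^⊤θ) / ∑_{ℓ=1}^p exp(x_ℓ^⊤θ) = θ_1 for every θ ∈ ℝ^L, where θ_1 is the first coordinate of θ. In other words, no function s: {x_1,…,x_p} → ℝ satisfies ∑_j A(x_j;θ) s(x_j) = θ_1 for all θ ∈ ℝ^L. -/
open scoped BigOperators

noncomputable section
namespace SM

/-- Remark (no exact moment functional exists for nonrandom features): for any `p ≥ 1`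
and any points `x_1, …, x_p ∈ ℝ^L`, there are no reals `β_1, …, β_p` with
`∑_j A(x_j;θ) β_j = θ_1` for every `θ ∈ ℝ^L`. -/
theorem no_exact_first_moment_functional :
    ∀ (L p : ℕ) (hL : 0 < L), 0 < p →
    ∀ x : Fin p → Vec L,
      ¬ ∃ β : Fin p → ℝ, ∀ θ : Vec L, ∑ j, softA x θ j * β j = θ ⟨0, hL⟩ := by
  rintro L p hL hp x ⟨β, h⟩
  have key := h (fun _ => (∑ j, |β j|) + 1)
  have hle : ∑ j, softA x (fun _ => (∑ j, |β j|) + 1) j * β j ≤ ∑ j, |β j| := by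
    refine Finset.sum_le_sum fun j _ => ?_
    have h0 : 0 ≤ softA x (fun _ => (∑ j, |β j|) + 1) j := by
      unfold softA
      positivity
    have h1 : softA x (fun _ => (∑ j, |β j|) + 1) j ≤ 1 := by
      unfold softA
      refine div_le_one_of_le₀ ?_ (by positivity)
      exact Finset.single_le_sum
        (f := fun i => Real.exp (dot (x i) (fun _ => (∑ j, |β j|) + 1)))
        (fun i _ => (Real.exp_pos _).le) (Finset.mem_univ j)
    calc _ ≤ softA x (fun _ => (∑ j, |β j|) + 1) j * |β j| :=
          mul_le_mul_of_nonneg_left (le_abs_self _) h0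
      _ ≤ 1 * |β j| := mul_le_mul_of_nonneg_right h1 (abs_nonneg _)
      _ = |β j| := one_mul _
  rw [key] at hle
  linarith

end SM
end
end

section
/- For every integer K ≥ 2 there exist constants c_K > 0 and C_K > 0 such that for all sufficiently small Δ > 0 there exist K-atomic probability measures ρ = ∑_{k=1}^K α_k δ_{θ_k} and ρ' = ∑_{k=1}^K α_k' δ_{θ_k'} supported on [−1, 1] whose atoms (within each measure and across the two measures) are pairwise separated by at least Δ, whose first 2K−2 moments coincide, and such that ‖θ_k' − θ_k‖ ≥ C_K Δ^{−2K+2} ‖m − m'‖_2 for all k ∈ [K], where m, m' ∈ ℝ^{2K−1} are the vectors of the first 2K−1 moments of ρ and ρ', respectively. -/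
open scoped BigOperators

noncomputable section
namespace SM

open scoped fwdDiff in
lemma alt_sum (n r : ℕ) (h : r < n) :
    ∑ j ∈ Finset.range (n + 1), ((-1 : ℝ)) ^ j * (n.choose j) * (j : ℝ) ^ r = 0 := by
  have h1 := fwdDiff_iter_pow_eq_zero_of_lt (R := ℝ) h
  have h2 := fwdDiff_iter_eq_sum_shift (1 : ℝ) (fun x : ℝ => x ^ r) n 0
  rw [h1] at h2
  have h3 : ∑ j ∈ Finset.range (n + 1), ((-1 : ℝ)) ^ j * (n.choose j) * (j : ℝ) ^ r
      = (-1) ^ n * ∑ k ∈ Finset.range (n + 1),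
        ((-1 : ℤ) ^ (n - k) * n.choose k) • (fun x : ℝ => x ^ r) (0 + k • (1 : ℝ)) := by
    rw [Finset.mul_sum]
    refine Finset.sum_congr rfl fun j hj => ?_
    have hj' : j ≤ n := by simpa [Nat.lt_succ_iff] using hj
    obtain ⟨m, rfl⟩ := Nat.exists_eq_add_of_le hj'
    have e : ((-1 : ℝ)) ^ m * (-1) ^ m = 1 := by rw [← mul_pow]; simp
    simp only [Nat.add_sub_cancel_left, zsmul_eq_mul, nsmul_eq_mul, pow_add]
    push_cast
    simp only [zero_add, mul_one]
    linear_combination (-((-1 : ℝ) ^ j * ((j + m).choose j) * (j : ℝ) ^ r)) * e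
  rw [h3, ← h2]
  simp

lemma sum_pairs (f : ℕ → ℝ) (K : ℕ) :
    ∑ j ∈ Finset.range (2 * K), f j = ∑ k ∈ Finset.range K, (f (2 * k) + f (2 * k + 1)) := by
  induction K with
  | zero => simp
  | succ K ih =>
    rw [show 2 * (K + 1) = 2 * K + 1 + 1 by ring, Finset.sum_range_succ, Finset.sum_range_succ,
      Finset.sum_range_succ, ih]
    ring

lemma alt_sum' (K r : ℕ) (hK : 2 ≤ K) (h : r < 2 * K - 1) :
    ∑ k : Fin K, ((2 * K - 1).choose (2 * (k : ℕ)) : ℝ) * (2 * (k : ℕ) : ℝ) ^ r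
     = ∑ k : Fin K, ((2 * K - 1).choose (2 * (k : ℕ) + 1) : ℝ) * (2 * (k : ℕ) + 1 : ℝ) ^ r := by
  have h1 := alt_sum (2 * K - 1) r h
  rw [show 2 * K - 1 + 1 = 2 * K by omega, sum_pairs, Finset.sum_add_distrib,
    Finset.sum_range, Finset.sum_range] at h1
  simp only [pow_succ (-1 : ℝ), pow_mul] at h1
  simp at h1
  linarith

lemma sep (Δ : ℝ) (hΔ : 0 < Δ) (a b : ℤ) (h : a ≠ b) : Δ ≤ |Δ * a - Δ * b| := by
  rw [← mul_sub, abs_mul, abs_of_pos hΔ]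
  have : (1 : ℝ) ≤ |(a : ℝ) - b| := by
    exact_mod_cast Int.one_le_abs (sub_ne_zero.mpr h)
  nlinarith

/-- Lower bound showing the exponential-in-`K` dependence is unavoidable: for every
`K ≥ 2` there are constants `c_K, C_K > 0` such that for all sufficiently small `Δ > 0`
there exist `K`-atomic probability measures `ρ = ∑ α_k δ_{θ_k}` and `ρ' = ∑ α_k' δ_{θ_k'}`
on `[-1,1]`, with all atoms (within each measure and across the two measures) pairwise
separated by at least `Δ`, whose moments of orders `1, …, 2K-2` coincide, and with
`|θ_k' - θ_k| ≥ C_K Δ^{-2K+2} ‖m - m'‖₂` for all `k`, where `m, m'` collect the moments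
of orders `1, …, 2K-1` of `ρ` and `ρ'`. -/
theorem moment_separation_lower_bound :
    ∀ K : ℕ, 2 ≤ K →
    ∃ cK CK : ℝ, 0 < cK ∧ 0 < CK ∧
    ∃ Δ0 : ℝ, 0 < Δ0 ∧
    ∀ Δ : ℝ, 0 < Δ → Δ < Δ0 →
    ∃ (α α' θ θ' : Fin K → ℝ),
      (∀ k, 0 < α k) ∧ (∀ k, 0 < α' k) ∧
      (∑ k, α k = 1) ∧ (∑ k, α' k = 1) ∧
      (∀ k, θ k ∈ Set.Icc (-1 : ℝ) 1) ∧ (∀ k, θ' k ∈ Set.Icc (-1 : ℝ) 1) ∧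
      (∀ k k', k ≠ k' → Δ ≤ |θ k - θ k'|) ∧
      (∀ k k', k ≠ k' → Δ ≤ |θ' k - θ' k'|) ∧
      (∀ k k', Δ ≤ |θ k - θ' k'|) ∧
      (∀ r : ℕ, 1 ≤ r → r ≤ 2 * K - 2 → ∑ k, α k * θ k ^ r = ∑ k, α' k * θ' k ^ r) ∧
      (∀ k, CK / Δ ^ (2 * K - 2) *
          Real.sqrt (∑ r ∈ Finset.Icc 1 (2 * K - 1),
            (∑ k', α k' * θ k' ^ r - ∑ k', α' k' * θ' k' ^ r) ^ 2)
        ≤ |θ' k - θ k|) := by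
  intro K hK
  set n := 2 * K - 1 with hn
  set A : ℕ → ℝ := fun r => ∑ k : Fin K, (n.choose (2 * (k : ℕ)) : ℝ) * (2 * (k : ℕ) : ℝ) ^ r
    with hA
  set B : ℕ → ℝ := fun r =>
    ∑ k : Fin K, (n.choose (2 * (k : ℕ) + 1) : ℝ) * (2 * (k : ℕ) + 1 : ℝ) ^ r with hB
  have hAB : ∀ r, r < n → A r = B r := fun r hr => alt_sum' K r hK hr
  have hS : 0 < A 0 := by
    simp only [hA, pow_zero, mul_one]
    refine Finset.sum_pos (fun k _ => ?_) ⟨⟨0, by omega⟩, Finset.mem_univ _⟩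
    exact_mod_cast Nat.choose_pos (by have := k.2; omega)
  set S := A 0 with hSd
  have hSB : B 0 = S := (hAB 0 (by omega)).symm
  set D := |(A n - B n) / S| with hD
  have hD0 : 0 ≤ D := abs_nonneg _
  refine ⟨1, 1 / (D + 1), one_pos, by positivity, 1 / (2 * K), by positivity, ?_⟩
  intro Δ hΔ hΔ0
  have hb : Δ * (2 * K) ≤ 1 := by
    rw [lt_div_iff₀ (by positivity)] at hΔ0; exact hΔ0.le
  have mA : ∀ r, ∑ k : Fin K, ((n.choose (2 * (k : ℕ)) : ℝ) / S) * (Δ * (2 * (k : ℕ) : ℝ)) ^ r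
      = Δ ^ r * A r / S := by
    intro r
    simp only [hA, Finset.mul_sum, Finset.sum_div]
    refine Finset.sum_congr rfl fun k _ => ?_
    rw [mul_pow]; ring
  have mB : ∀ r, ∑ k : Fin K,
      ((n.choose (2 * (k : ℕ) + 1) : ℝ) / S) * (Δ * (2 * (k : ℕ) + 1 : ℝ)) ^ r
      = Δ ^ r * B r / S := by
    intro r
    simp only [hB, Finset.mul_sum, Finset.sum_div]
    refine Finset.sum_congr rfl fun k _ => ?_
    rw [mul_pow]; ring
  have hk : ∀ k : Fin K, ((k : ℕ) : ℝ) + 1 ≤ K := fun k => by exact_mod_cast k.2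
  refine ⟨fun k => (n.choose (2 * (k : ℕ)) : ℝ) / S, fun k => (n.choose (2 * (k : ℕ) + 1) : ℝ) / S,
    fun k => Δ * (2 * (k : ℕ) : ℝ), fun k => Δ * (2 * (k : ℕ) + 1 : ℝ),
    ?_, ?_, ?_, ?_, ?_, ?_, ?_, ?_, ?_, ?_, ?_⟩
  · intro k
    have : 0 < n.choose (2 * (k : ℕ)) := Nat.choose_pos (by have := k.2; omega)
    positivity
  · intro k
    have : 0 < n.choose (2 * (k : ℕ) + 1) := Nat.choose_pos (by have := k.2; omega)
    positivity
  · have := mA 0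
    simp only [pow_zero, mul_one, one_mul] at this
    rw [this, ← hSd, div_self hS.ne']
  · have := mB 0
    simp only [pow_zero, mul_one, one_mul] at this
    rw [this, hSB, div_self hS.ne']
  · intro k
    have h0 : 0 ≤ Δ * (2 * (k : ℕ) : ℝ) := by positivity
    exact ⟨by linarith, by nlinarith [hk k]⟩
  · intro k
    have h0 : 0 ≤ Δ * (2 * (k : ℕ) + 1 : ℝ) := by positivity
    exact ⟨by linarith, by nlinarith [hk k]⟩
  · intro k k' h
    have := sep Δ hΔ (2 * (k : ℕ)) (2 * (k' : ℕ)) (by have := Fin.val_ne_of_ne h; omega)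
    push_cast at this; exact this
  · intro k k' h
    have := sep Δ hΔ (2 * (k : ℕ) + 1) (2 * (k' : ℕ) + 1) (by have := Fin.val_ne_of_ne h; omega)
    push_cast at this; exact this
  · intro k k'
    have := sep Δ hΔ (2 * (k : ℕ)) (2 * (k' : ℕ) + 1) (by omega)
    push_cast at this; exact this
  · intro r _ hr
    simp only [mA, mB]
    rw [hAB r (by omega)]
  · intro k
    simp only [mA, mB]
    rw [Finset.sum_eq_single_of_mem n (Finset.mem_Icc.mpr ⟨by omega, le_rfl⟩) (by
      intro r hr hne
      rw [hAB r (by have := (Finset.mem_Icc.mp hr).2; omega)]; ring), Real.sqrt_sq_eq_abs]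
    have e1 : Δ ^ n * A n / S - Δ ^ n * B n / S = Δ ^ n * ((A n - B n) / S) := by ring
    have e2 : Δ * (2 * (k : ℕ) + 1 : ℝ) - Δ * (2 * (k : ℕ) : ℝ) = Δ := by ring
    have e3 : n = (2 * K - 2) + 1 := by omega
    rw [e1, e2, abs_mul, ← hD, abs_of_pos hΔ, abs_of_pos (pow_pos hΔ n)]
    have e4 : Δ ^ n = Δ ^ (2 * K - 2) * Δ := by rw [e3, pow_succ]
    rw [e4]
    have hp : 0 < Δ ^ (2 * K - 2) := pow_pos hΔ _
    have e5 : 1 / (D + 1) / Δ ^ (2 * K - 2) * (Δ ^ (2 * K - 2) * Δ * D) = Δ * (D / (D + 1)) := by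
      field_simp
    rw [e5]
    have : D / (D + 1) ≤ 1 := by rw [div_le_one (by positivity)]; linarith
    nlinarith

end SM
end
end
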